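/- Let f, g ∈ L¹(ℝ²) ∩ L^∞(ℝ²) be nonnegative with ∫ f dx = ∫ g dx, and let π be a coupling of f and g, i.e., a nonnegative measure on ℝ² × ℝ² with first marginal f(x)dx and second marginal g(y)dy. Then the associated Biot–Savart velocity fields satisfy ‖K ⋆ f − K ⋆ g‖_{L²(ℝ²)} ≤ max( ‖f‖_{L^∞}, ‖g‖_{L^∞} )^{1/2} ( ∬_{ℝ²×ℝ²} |x − y|² dπ(x,y) )^{1/2}. (Equivalently, ‖f − g‖_{Ḣ^{−1}} ≤ max(‖f‖_{L^∞}, ‖g‖_{L^∞})^{1/2} W₂(f,g).) -/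

import Mathlib

open MeasureTheory Real
open scoped ENNReal RealInnerProductSpace

noncomputable section

abbrev E2 : Type := EuclideanSpace ℝ (Fin 2)

/-- Counterclockwise rotation by 90 degrees: `x^⊥ = (-x₂, x₁)`. -/
def perp (x : E2) : E2 := !₂[-x 1, x 0]

/-- The Biot–Savart kernel `K(x) = (1/(2π)) x^⊥/|x|²`. -/
def biotSavartKernel (x : E2) : E2 := (1 / (2 * π * ‖x‖ ^ 2)) • perp x

/-- The Biot–Savart law: `(K ⋆ ω)(x) = ∫ K(x - y) ω(y) dy`. -/
def biotSavart (ω : E2 → ℝ) (x : E2) : E2 := ∫ y : E2, ω y • biotSavartKernel (x - y)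

/-- The Laplacian on `ℝ²`, as the sum of the second partial derivatives. -/
def lap (f : E2 → ℝ) (x : E2) : ℝ :=
  ∑ i : Fin 2, fderiv ℝ (fun y => fderiv ℝ f y (EuclideanSpace.single i 1)) x
    (EuclideanSpace.single i 1)

/-- `ρ` solves the advection–diffusion equation `∂ₜρ + b·∇ρ = ν Δρ` for positive times. -/
def IsAdvDiffSol (ν : ℝ) (b : ℝ → E2 → E2) (ρ : ℝ → E2 → ℝ) : Prop :=
  ∀ t > (0 : ℝ), ∀ x, HasDerivAt (fun s => ρ s x)
    (ν * lap (ρ t) x - ⟪b t x, gradient (ρ t) x⟫) t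

/-- `ρ` solves the transport equation `∂ₜρ + b·∇ρ = 0` for positive times. -/
def IsTransportSol (b : ℝ → E2 → E2) (ρ : ℝ → E2 → ℝ) : Prop :=
  ∀ t > (0 : ℝ), ∀ x, HasDerivAt (fun s => ρ s x) (-⟪b t x, gradient (ρ t) x⟫) t

/-- `γ` is a coupling of the nonnegative densities `f` and `g`: its marginals are
`f dx` and `g dy`. -/
def IsCoupling (f g : E2 → ℝ) (γ : Measure (E2 × E2)) : Prop :=
  γ.map Prod.fst = volume.withDensity (fun x => ENNReal.ofReal (f x)) ∧
  γ.map Prod.snd = volume.withDensity (fun y => ENNReal.ofReal (g y))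

/-- The 2-Wasserstein distance between two nonnegative densities, as the infimum of the
square root of the quadratic transport cost over all couplings. -/
def W2 (f g : E2 → ℝ) : ℝ≥0∞ :=
  ⨅ (γ : Measure (E2 × E2)) (_ : IsCoupling f g γ),
    (∫⁻ p : E2 × E2, ENNReal.ofReal (‖p.1 - p.2‖ ^ 2) ∂γ) ^ (1 / 2 : ℝ)

section Auxiliary

open Filter Topology Set
open scoped NNReal BoundedContinuousFunction

local instance compactSpace_closedBall (R : ℝ) : CompactSpace (Metric.closedBall (0 : E2) R) :=
  isCompact_iff_compactSpace.1 (isCompact_closedBall _ _)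

lemma det_eq_entries (A : E2 →L[ℝ] E2) :
    A.det = A (EuclideanSpace.single 0 1) 0 * A (EuclideanSpace.single 1 1) 1
      - A (EuclideanSpace.single 1 1) 0 * A (EuclideanSpace.single 0 1) 1 := by
  rw [ContinuousLinearMap.det, ← LinearMap.det_toMatrix (EuclideanSpace.basisFun (Fin 2) ℝ).toBasis,
    Matrix.det_fin_two]
  simp [LinearMap.toMatrix_apply]

lemma disc_nonneg_of_quadratic_nonneg {p q r : ℝ} (hp : 0 ≤ p)
    (h : ∀ x y : ℝ, 0 ≤ p * x ^ 2 + 2 * q * x * y + r * y ^ 2) : 0 ≤ p * r - q * q := by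
  rcases hp.eq_or_lt with rfl | hp
  · by_contra! hneg
    have hq : 0 < q * q := by linarith
    have := h (-(r + 1) * q) (2 * (q * q))
    nlinarith [mul_pos hq hq, mul_pos (mul_pos hq hq) hq]
  · have := h q (-p)
    have h2 : 0 ≤ p * (p * r - q * q) := by nlinarith
    exact nonneg_of_mul_nonneg_right h2 hp

lemma two_lt_mixed_discriminant {p q r p' q' r' : ℝ} (hp : 0 ≤ p) (hr : 0 ≤ r) (hp' : 0 ≤ p')
    (hr' : 0 ≤ r') (h : 1 < p * r - q * q) (h' : 1 < p' * r' - q' * q') :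
    2 < p * r' + r * p' - 2 * (q * q') := by
  have h1 : (1 + q * q) * (1 + q' * q') < (p * r) * (p' * r') :=
    mul_lt_mul'' (by linarith) (by linarith)
      (by nlinarith [mul_self_nonneg q]) (by nlinarith [mul_self_nonneg q'])
  have h2 : (1 + q * q') ^ 2 < ((p * r' + r * p') / 2) ^ 2 := by
    nlinarith [sq_nonneg (p * r' - r * p'), sq_nonneg (q - q')]
  have := lt_of_pow_lt_pow_left₀ 2 (by positivity) h2
  linarith

/-- If `A` is symmetric with `0 ≤ A` and `t A ≤ 1`, then `A` and `(1 - t A) / (1 - t)` cannot both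
have determinant larger than one. -/
lemma abs_det_le_one_or {t : ℝ} (ht0 : 0 < t) (ht1 : t < 1) (A : E2 →L[ℝ] E2)
    (hsym : ∀ v w, ⟪A v, w⟫ = ⟪A w, v⟫) (hpos : ∀ v, 0 ≤ ⟪A v, v⟫)
    (hle : ∀ v, t * ⟪A v, v⟫ ≤ ⟪v, v⟫) :
    |A.det| ≤ 1 ∨ |((1 - t)⁻¹ • (ContinuousLinearMap.id ℝ E2 - t • A)).det| ≤ 1 := by
  set a := A (EuclideanSpace.single 0 1) 0 with ha
  set b := A (EuclideanSpace.single 1 1) 0 with hb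
  set d := A (EuclideanSpace.single 1 1) 1 with hd
  have hb' : A (EuclideanSpace.single 0 1) 1 = b := by
    have := hsym (EuclideanSpace.single 0 1) (EuclideanSpace.single 1 1)
    simpa [EuclideanSpace.inner_single_right] using this
  have hv : ∀ x y : ℝ, A (EuclideanSpace.single 0 x + EuclideanSpace.single 1 y)
      = x • A (EuclideanSpace.single 0 1) + y • A (EuclideanSpace.single 1 1) := by
    intro x y
    rw [← map_smul, ← map_smul, ← map_add]
    congr 2 <;> ext i <;> simp
  have hq : ∀ x y : ℝ, ⟪A (EuclideanSpace.single 0 x + EuclideanSpace.single 1 y),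
      EuclideanSpace.single 0 x + EuclideanSpace.single 1 y⟫ = a * x ^ 2 + 2 * b * x * y + d * y ^ 2 := by
    intro x y
    rw [hv]
    simp [PiLp.inner_apply, Fin.sum_univ_two, hb', ← ha, ← hb, ← hd]
    ring
  have hn : ∀ x y : ℝ, ⟪(EuclideanSpace.single 0 x + EuclideanSpace.single 1 y : E2),
      EuclideanSpace.single 0 x + EuclideanSpace.single 1 y⟫ = x ^ 2 + y ^ 2 := by
    intro x y
    rw [PiLp.inner_apply, Fin.sum_univ_two]
    simp
  have hdetA : A.det = a * d - b * b := by rw [det_eq_entries, hb']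
  have hs : (1 - t) ≠ 0 := by linarith
  have hdetB : ((1 - t)⁻¹ • (ContinuousLinearMap.id ℝ E2 - t • A)).det
      = ((1 - t)⁻¹) ^ 2 * ((1 - t * a) * (1 - t * d) - (t * b) ^ 2) := by
    rw [det_eq_entries]
    generalize (1 - t)⁻¹ = c
    simp [hb', ← ha, ← hb, ← hd]
    ring
  have P : ∀ x y : ℝ, 0 ≤ a * x ^ 2 + 2 * b * x * y + d * y ^ 2 := fun x y => by
    rw [← hq]; exact hpos _
  have Q : ∀ x y : ℝ, t * (a * x ^ 2 + 2 * b * x * y + d * y ^ 2) ≤ x ^ 2 + y ^ 2 := fun x y => by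
    rw [← hq, ← hn]; exact hle _
  have ha0 : 0 ≤ a := by simpa using P 1 0
  have hd0 : 0 ≤ d := by simpa using P 0 1
  have ha1 : 0 ≤ 1 - t * a := by have := Q 1 0; simp at this; linarith
  have hd1 : 0 ≤ 1 - t * d := by have := Q 0 1; simp at this; linarith
  have hA0 : 0 ≤ a * d - b * b := disc_nonneg_of_quadratic_nonneg ha0 P
  have hB0 : 0 ≤ (1 - t * a) * (1 - t * d) - (-(t * b)) * (-(t * b)) :=
    disc_nonneg_of_quadratic_nonneg ha1 (fun x y => by linarith [Q x y])
  rw [hdetA, hdetB, abs_of_nonneg hA0, abs_of_nonneg (mul_nonneg (sq_nonneg _) (by linarith))]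
  by_contra! hcon
  obtain ⟨h1, h2⟩ := hcon
  set s := 1 - t with hs'
  have hspos : 0 < s := by linarith
  set α := (1 - t * a) / s with hα
  set δ := (1 - t * d) / s with hδ
  set β := -(t * b) / s with hβ
  have h2' : 1 < α * δ - β * β := by
    have : α * δ - β * β = (s⁻¹) ^ 2 * ((1 - t * a) * (1 - t * d) - (t * b) ^ 2) := by
      rw [hα, hδ, hβ]; field_simp
    rw [this]; exact h2
  have e1 : t * a + s * α = 1 := by rw [hα]; field_simp; ring
  have e2 : t * d + s * δ = 1 := by rw [hδ]; field_simp; ring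
  have e3 : t * b + s * β = 0 := by rw [hβ]; field_simp; ring
  have hα0 : 0 ≤ α := div_nonneg ha1 hspos.le
  have hδ0 : 0 ≤ δ := div_nonneg hd1 hspos.le
  have hmix := two_lt_mixed_discriminant ha0 hd0 hα0 hδ0 h1 h2'
  have hone : (t * a + s * α) * (t * d + s * δ) - (t * b + s * β) * (t * b + s * β) = 1 := by
    rw [e1, e2, e3]; ring
  have hexp : t ^ 2 * (a * d - b * b) + s ^ 2 * (α * δ - β * β)
      + t * s * (a * δ + d * α - 2 * (b * β)) = 1 := by rw [← hone]; ring
  have hts : t + s = 1 := by rw [hs']; ring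
  have : t ^ 2 + s ^ 2 + t * s * 2 < 1 := by
    have := mul_lt_mul_of_pos_left h1 (pow_pos ht0 2)
    have := mul_lt_mul_of_pos_left h2' (pow_pos hspos 2)
    have := mul_lt_mul_of_pos_left hmix (mul_pos ht0 hspos)
    linarith
  nlinarith

lemma norm_sq_segment (s : ℝ) (y y' : E2) :
    ‖(1 - s) • y + s • y'‖ ^ 2 = (1 - s) * ‖y‖ ^ 2 + s * ‖y'‖ ^ 2 - s * (1 - s) * ‖y' - y‖ ^ 2 := by
  rw [norm_add_sq_real, norm_sub_sq_real, norm_smul, norm_smul, mul_pow, mul_pow,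
    inner_smul_left, inner_smul_right, real_inner_comm y y']
  simp
  ring

/-- `y` minimizes `(1 - t) v + t |·|² / 2 - ⟪w, ·⟫` over the closed ball of radius `R`, with the
quadratic growth coming from strong convexity. -/
def IsStrongMin (R t : ℝ) (v : E2 → ℝ) (w y : E2) : Prop :=
  y ∈ Metric.closedBall (0 : E2) R ∧ ∀ y' ∈ Metric.closedBall (0 : E2) R,
    (1 - t) * v y + t / 2 * ‖y‖ ^ 2 - ⟪w, y⟫ + t / 2 * ‖y' - y‖ ^ 2
      ≤ (1 - t) * v y' + t / 2 * ‖y'‖ ^ 2 - ⟪w, y'⟫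

lemma exists_isStrongMin {R t : ℝ} (hR : 0 ≤ R) (ht1 : t < 1) {v : E2 → ℝ}
    (hv : ConvexOn ℝ univ v) (hc : Continuous v) (w : E2) : ∃ y, IsStrongMin R t v w y := by
  obtain ⟨y, hy, hmin⟩ := (isCompact_closedBall (0 : E2) R).exists_isMinOn
    ⟨0, by simpa using hR⟩ (f := fun y => (1 - t) * v y + t / 2 * ‖y‖ ^ 2 - ⟪w, y⟫)
    (by fun_prop)
  refine ⟨y, hy, fun y' hy' => ?_⟩
  have key : ∀ s ∈ Ioo (0 : ℝ) 1, (1 - t) * v y + t / 2 * ‖y‖ ^ 2 - ⟪w, y⟫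
      + t / 2 * (1 - s) * ‖y' - y‖ ^ 2 ≤ (1 - t) * v y' + t / 2 * ‖y'‖ ^ 2 - ⟪w, y'⟫ := by
    intro s hs
    have h1 := hmin ((convex_closedBall (0 : E2) R) hy hy' (by linarith [hs.2] : 0 ≤ 1 - s)
      hs.1.le (by ring))
    have h2 := hv.2 (mem_univ y) (mem_univ y') (by linarith [hs.2] : 0 ≤ 1 - s) hs.1.le (by ring)
    simp only [mem_ofPred_eq, norm_sq_segment, inner_add_right, inner_smul_right] at h1
    simp only [smul_eq_mul] at h2
    have h3 := mul_le_mul_of_nonneg_left h2 (by linarith : 0 ≤ 1 - t)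
    have h4 : s * ((1 - t) * v y + t / 2 * ‖y‖ ^ 2 - ⟪w, y⟫
      + t / 2 * (1 - s) * ‖y' - y‖ ^ 2) ≤ s * ((1 - t) * v y' + t / 2 * ‖y'‖ ^ 2 - ⟪w, y'⟫) := by
      linarith
    exact le_of_mul_le_mul_left h4 hs.1
  have hlim : Tendsto (fun s : ℝ => (1 - t) * v y + t / 2 * ‖y‖ ^ 2 - ⟪w, y⟫
      + t / 2 * (1 - s) * ‖y' - y‖ ^ 2) (𝓝[>] 0) (𝓝 ((1 - t) * v y + t / 2 * ‖y‖ ^ 2 - ⟪w, y⟫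
      + t / 2 * (1 - 0) * ‖y' - y‖ ^ 2)) :=
    tendsto_nhdsWithin_of_tendsto_nhds (Continuous.tendsto (by fun_prop) 0)
  have := le_of_tendsto hlim (eventually_of_mem (Ioo_mem_nhdsGT one_pos) key)
  simpa using this

lemma isStrongMin_of_subgradient {R t : ℝ} (ht0 : 0 < t) (ht1 : t < 1) {v : E2 → ℝ} {y p y₀ : E2}
    (hy : y ∈ Metric.closedBall (0 : E2) R) (hp : ∀ y', v y + ⟪p, y' - y⟫ ≤ v y')
    (h₀ : IsStrongMin R t v ((1 - t) • p + t • y) y₀) : y₀ = y := by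
  have h1 := h₀.2 y hy
  have h2 := mul_le_mul_of_nonneg_left (hp y₀) (by linarith : 0 ≤ 1 - t)
  simp only [inner_add_left, inner_smul_left, inner_sub_right, conj_trivial,
    real_inner_self_eq_norm_sq] at h1 h2
  have h3 := norm_sub_sq_real y y₀
  have h4 : ‖y - y₀‖ ^ 2 ≤ 0 := by nlinarith
  have h5 : ‖y - y₀‖ = 0 := by nlinarith [norm_nonneg (y - y₀)]
  exact (sub_eq_zero.1 (norm_eq_zero.1 h5)).symm

section Resolvent

variable {R t : ℝ} {v : E2 → ℝ} {Y : E2 → E2}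

lemma resolvent_mono (hY : ∀ w, IsStrongMin R t v w (Y w)) (w w' : E2) :
    t * ‖Y w - Y w'‖ ^ 2 ≤ ⟪Y w - Y w', w - w'⟫ := by
  have h1 := (hY w).2 (Y w') (hY w').1
  have h2 := (hY w').2 (Y w) (hY w).1
  rw [norm_sub_rev] at h1
  simp only [inner_sub_left, inner_sub_right, real_inner_comm] at *
  linarith

lemma resolvent_norm_le (hY : ∀ w, IsStrongMin R t v w (Y w)) (w w' : E2) :
    t * ‖Y w - Y w'‖ ≤ ‖w - w'‖ := by
  have h1 := (resolvent_mono hY w w').trans (real_inner_le_norm _ _)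
  rcases (norm_nonneg (Y w - Y w')).eq_or_lt with h | h
  · rw [← h]; simp
  · refine le_of_mul_le_mul_right ?_ h
    nlinarith

lemma resolvent_lipschitz (ht0 : 0 < t) (hY : ∀ w, IsStrongMin R t v w (Y w)) :
    LipschitzWith (Real.toNNReal t⁻¹) Y := by
  refine LipschitzWith.of_dist_le_mul fun w w' => ?_
  rw [dist_eq_norm, dist_eq_norm, Real.coe_toNNReal _ (by positivity), inv_mul_eq_div,
    le_div_iff₀ ht0, mul_comm]
  exact resolvent_norm_le hY w w'

lemma hasFDerivAt_resolvent_potential (ht0 : 0 < t) (hY : ∀ w, IsStrongMin R t v w (Y w)) (w : E2) :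
    HasFDerivAt (fun w => ⟪w, Y w⟫ - (1 - t) * v (Y w) - t / 2 * ‖Y w‖ ^ 2)
      (innerSL ℝ (Y w)) w := by
  refine HasFDerivAt.of_isLittleO ?_
  have hO : (fun w' => ‖w' - w‖ * ‖w' - w‖) =o[𝓝 w] fun w' => w' - w := by
    have h1 : (fun w' => ‖w' - w‖) =o[𝓝 w] fun _ => (1 : ℝ) := by
      rw [Asymptotics.isLittleO_one_iff]
      exact Continuous.tendsto' (by fun_prop) _ _ (by simp)
    have h2 : (fun w' => ‖w' - w‖) =O[𝓝 w] fun w' => w' - w :=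
      (Asymptotics.isBigO_refl _ _).norm_left
    simpa using h1.mul_isBigO h2.norm_right
  refine Asymptotics.IsBigO.trans_isLittleO ?_ hO
  refine Asymptotics.IsBigO.of_bound t⁻¹ (Eventually.of_forall fun w' => ?_)
  have h1 := (hY w).2 (Y w') (hY w').1
  have h2 := (hY w').2 (Y w) (hY w).1
  have h3 : 0 ≤ t / 2 * ‖Y w' - Y w‖ ^ 2 := by positivity
  have h4 : 0 ≤ t / 2 * ‖Y w - Y w'‖ ^ 2 := by positivity
  have h5 := resolvent_norm_le hY w' w
  have h6 : ⟪Y w' - Y w, w' - w⟫ ≤ t⁻¹ * (‖w' - w‖ * ‖w' - w‖) := by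
    refine (real_inner_le_norm _ _).trans ?_
    rw [← mul_assoc]
    refine mul_le_mul_of_nonneg_right ?_ (norm_nonneg _)
    rw [inv_mul_eq_div, le_div_iff₀ ht0, mul_comm]
    exact h5
  rw [Real.norm_eq_abs, Real.norm_of_nonneg (by positivity), abs_le]
  simp only [innerSL_apply_apply, inner_sub_right, inner_sub_left] at *
  simp only [real_inner_comm w', real_inner_comm w] at *
  constructor <;> linarith

lemma resolvent_inner_fderiv_nonneg (ht0 : 0 < t) (hY : ∀ w, IsStrongMin R t v w (Y w)) {w : E2}
    (hd : DifferentiableAt ℝ Y w) (h : E2) :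
    0 ≤ ⟪fderiv ℝ Y w h, h⟫ ∧ t * ⟪fderiv ℝ Y w h, h⟫ ≤ ⟪h, h⟫ := by
  have hl : HasDerivAt (fun s : ℝ => ⟪Y (w + s • h), h⟫) ⟪fderiv ℝ Y w h, h⟫ 0 := by
    have hg : HasDerivAt (fun s : ℝ => w + s • h) h 0 := by
      simpa using ((hasDerivAt_id (0 : ℝ)).smul_const h).const_add w
    have h1 : HasFDerivAt Y (fderiv ℝ Y w) (w + (0 : ℝ) • h) := by simpa using hd.hasFDerivAt
    have h2 := h1.comp_hasDerivAt (0 : ℝ) hg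
    simpa using h2.inner ℝ (hasDerivAt_const (0 : ℝ) h)
  have hdiff : ∀ a b : ℝ, (b - a) * (⟪Y (w + b • h), h⟫ - ⟪Y (w + a • h), h⟫)
      = ⟪Y (w + b • h) - Y (w + a • h), (w + b • h) - (w + a • h)⟫ := by
    intro a b
    rw [show (w + b • h) - (w + a • h) = (b - a) • h by module, inner_smul_right, inner_sub_left]
  constructor
  · have hm : Monotone (fun s : ℝ => ⟪Y (w + s • h), h⟫) := by
      intro a b hab
      rcases hab.eq_or_lt with rfl | hab
      · exact le_rfl
      have h1 := resolvent_mono hY (w + b • h) (w + a • h)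
      rw [← hdiff] at h1
      have : 0 ≤ (b - a) * (⟪Y (w + b • h), h⟫ - ⟪Y (w + a • h), h⟫) := le_trans (by positivity) h1
      exact sub_nonneg.1 (nonneg_of_mul_nonneg_right this (by linarith))
    rw [← hl.deriv]
    exact hm.deriv_nonneg
  · have hm : Monotone (fun s : ℝ => s * ⟪h, h⟫ - t * ⟪Y (w + s • h), h⟫) := by
      intro a b hab
      rcases hab.eq_or_lt with rfl | hab
      · exact le_rfl
      have h1 : t * ((b - a) * (⟪Y (w + b • h), h⟫ - ⟪Y (w + a • h), h⟫))
          ≤ (b - a) * ((b - a) * ⟪h, h⟫) := by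
        rw [hdiff]
        have h2 := real_inner_le_norm (Y (w + b • h) - Y (w + a • h)) ((w + b • h) - (w + a • h))
        have h3 := resolvent_norm_le hY (w + b • h) (w + a • h)
        have h4 : ‖(w + b • h) - (w + a • h)‖ ^ 2 = (b - a) * ((b - a) * ⟪h, h⟫) := by
          rw [show (w + b • h) - (w + a • h) = (b - a) • h by module, norm_smul, mul_pow,
            real_inner_self_eq_norm_sq]
          simp
          ring
        rw [← h4]
        nlinarith [norm_nonneg ((w + b • h) - (w + a • h))]
      have h2 : (b - a) * (t * (⟪Y (w + b • h), h⟫ - ⟪Y (w + a • h), h⟫))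
          ≤ (b - a) * ((b - a) * ⟪h, h⟫) := by linarith
      have := le_of_mul_le_mul_left h2 (by linarith)
      simp only
      linarith
    have hd2 := ((hasDerivAt_id (0 : ℝ)).mul_const ⟪h, h⟫).sub (hl.const_mul t)
    have h0 := hm.deriv_nonneg (x := 0)
    have h1 : deriv (fun s : ℝ => s * ⟪h, h⟫ - t * ⟪Y (w + s • h), h⟫) 0
      = 1 * ⟪h, h⟫ - t * ⟪fderiv ℝ Y w h, h⟫ := hd2.deriv
    rw [h1] at h0
    linarith

lemma resolvent_fderiv_symm (ht0 : 0 < t) (hY : ∀ w, IsStrongMin R t v w (Y w)) {w : E2}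
    (hd : DifferentiableAt ℝ Y w) (h k : E2) :
    ⟪fderiv ℝ Y w h, k⟫ = ⟪fderiv ℝ Y w k, h⟫ := by
  have h1 : HasFDerivAt (fun w => innerSL ℝ (Y w)) ((innerSL ℝ).comp (fderiv ℝ Y w)) w :=
    (innerSL ℝ).hasFDerivAt.comp w hd.hasFDerivAt
  exact second_derivative_symmetric (fun y => hasFDerivAt_resolvent_potential ht0 hY y) h1 h k

end Resolvent

lemma volume_image_eq_zero_of_lipschitz {K : ℝ≥0} {Y : E2 → E2} (hY : LipschitzWith K Y)
    {s : Set E2} (hs : volume s = 0) : volume (Y '' s) = 0 := by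
  have h1 : (Measure.hausdorffMeasure ((2 : ℕ) : ℝ) : Measure E2) ≪ volume :=
    Measure.absolutelyContinuous_isAddHaarMeasure _ _
  have h2 : (volume : Measure E2) ≪ Measure.hausdorffMeasure ((2 : ℕ) : ℝ) :=
    Measure.absolutelyContinuous_isAddHaarMeasure _ _
  apply h2
  refine le_antisymm ((hY.hausdorffMeasure_image_le (by positivity) s).trans ?_) zero_le
  rw [h1 hs, mul_zero]

lemma volume_image_le_of_abs_det_le_one {Y : E2 → E2} {Y' : E2 → E2 →L[ℝ] E2} {s : Set E2}
    (hs : MeasurableSet s) (hY : ∀ x ∈ s, HasFDerivAt Y (Y' x) x) (hd : ∀ x ∈ s, |(Y' x).det| ≤ 1) :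
    volume (Y '' s) ≤ volume s := by
  refine (addHaar_image_le_lintegral_abs_det_fderiv volume hs
    fun x hx => (hY x hx).hasFDerivWithinAt).trans ?_
  calc _ ≤ ∫⁻ _ in s, 1 := by
        refine setLIntegral_mono' hs fun x hx => ?_
        simpa using hd x hx
    _ = volume s := by simp

/-- Displacement interpolation between two measures of density at most `M` along the subgradients
of a convex function has density at most `M`. -/
lemma map_displacement_le {M : ℝ≥0∞} {ν : Measure E2} {T : E2 → E2} {v : E2 → ℝ} {R t : ℝ}
    (hR : 0 ≤ R) (ht0 : 0 < t) (ht1 : t < 1) (hν : ν ≤ M • volume) (hT : Measurable T)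
    (hνT : ν.map T ≤ M • volume) (hv : ConvexOn ℝ univ v) (hc : Continuous v)
    (hsub : ∀ᵐ y ∂ν, y ∈ Metric.closedBall (0 : E2) R ∧ ∀ y', v y + ⟪T y, y' - y⟫ ≤ v y') :
    ν.map (fun y => (1 - t) • T y + t • y) ≤ M • volume := by
  choose Y hY using exists_isStrongMin (R := R) hR ht1 hv hc
  set w : E2 → E2 := fun y => (1 - t) • T y + t • y with hw
  have hwm : Measurable w := by fun_prop
  have ht1' : (1 - t) ≠ 0 := by linarith
  set X : E2 → E2 := fun w => (1 - t)⁻¹ • (w - t • Y w) with hX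
  have hYw : ∀ᵐ y ∂ν, Y (w y) = y := by
    filter_upwards [hsub] with y hy
    exact isStrongMin_of_subgradient ht0 ht1 hy.1 hy.2 (hY _)
  have hXw : ∀ᵐ y ∂ν, X (w y) = T y := by
    filter_upwards [hYw] with y hy
    rw [hX]
    simp only [hy]
    rw [hw]
    simp [smul_smul, ht1']
  have hF1 : ∀ B : Set E2, ν (w ⁻¹' B) ≤ M * volume (Y '' B) := by
    intro B
    calc ν (w ⁻¹' B) ≤ ν (Y '' B) := by
          refine measure_mono_ae ?_
          filter_upwards [hYw] with y hy hyB
          exact ⟨w y, hyB, hy⟩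
      _ ≤ _ := hν _
  have hF2 : ∀ B : Set E2, ν (w ⁻¹' B) ≤ M * volume (X '' B) := by
    intro B
    calc ν (w ⁻¹' B) ≤ ν (T ⁻¹' (X '' B)) := by
          refine measure_mono_ae ?_
          filter_upwards [hXw] with y hy hyB
          exact ⟨w y, hyB, hy⟩
      _ ≤ ν.map T (X '' B) := Measure.le_map_apply hT.aemeasurable _
      _ ≤ _ := hνT _
  have hlip := resolvent_lipschitz ht0 hY
  set D : Set E2 := {x | DifferentiableAt ℝ Y x} with hD
  have hDm : MeasurableSet D := measurableSet_of_differentiableAt ℝ Y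
  set S : Set E2 := {x | |(fderiv ℝ Y x).det| ≤ 1} with hS
  have hSm : MeasurableSet S :=
    measurableSet_le ((ContinuousLinearMap.continuous_det.measurable.comp
      (measurable_fderiv ℝ Y)).abs) measurable_const
  refine Measure.le_iff.2 fun A hA => ?_
  rw [Measure.map_apply hwm hA]
  have hN : ν (w ⁻¹' (A \ D)) ≤ 0 := by
    refine (hF1 _).trans ?_
    rw [volume_image_eq_zero_of_lipschitz hlip, mul_zero]
    exact measure_mono_null (fun x hx => hx.2) hlip.ae_differentiableAt
  have h1 : ν (w ⁻¹' (A ∩ D ∩ S)) ≤ M * volume (A ∩ D ∩ S) := by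
    refine (hF1 _).trans (mul_le_mul_right ?_ _)
    exact volume_image_le_of_abs_det_le_one ((hA.inter hDm).inter hSm)
      (fun x hx => hx.1.2.hasFDerivAt) (fun x hx => hx.2)
  have h2 : ν (w ⁻¹' ((A ∩ D) \ S)) ≤ M * volume ((A ∩ D) \ S) := by
    refine (hF2 _).trans (mul_le_mul_right ?_ _)
    refine volume_image_le_of_abs_det_le_one ((hA.inter hDm).diff hSm)
      (Y' := fun x => (1 - t)⁻¹ • (ContinuousLinearMap.id ℝ E2 - t • fderiv ℝ Y x))
      (fun x hx => ?_) (fun x hx => ?_)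
    · exact ((hasFDerivAt_id x).sub (hx.1.2.hasFDerivAt.const_smul t)).const_smul (1 - t)⁻¹
    · refine (abs_det_le_one_or ht0 ht1 (fderiv ℝ Y x) (fun h k => ?_) (fun h => ?_)
        (fun h => ?_)).resolve_left hx.2
      · exact resolvent_fderiv_symm ht0 hY hx.1.2 h k
      · exact (resolvent_inner_fderiv_nonneg ht0 hY hx.1.2 h).1
      · exact (resolvent_inner_fderiv_nonneg ht0 hY hx.1.2 h).2
  calc ν (w ⁻¹' A) ≤ ν (w ⁻¹' (A \ D) ∪ (w ⁻¹' (A ∩ D ∩ S) ∪ w ⁻¹' ((A ∩ D) \ S))) := by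
        refine measure_mono fun y hy => ?_
        by_cases h1 : w y ∈ D <;> by_cases h2 : w y ∈ S <;> simp_all
    _ ≤ ν (w ⁻¹' (A \ D)) + (ν (w ⁻¹' (A ∩ D ∩ S)) + ν (w ⁻¹' ((A ∩ D) \ S))) :=
        (measure_union_le _ _).trans (by gcongr; exact measure_union_le _ _)
    _ ≤ 0 + (M * volume (A ∩ D ∩ S) + M * volume ((A ∩ D) \ S)) := by gcongr
    _ = M * volume (A ∩ D) := by rw [zero_add, ← mul_add, measure_inter_add_sdiff _ hSm]
    _ ≤ M * volume A := by gcongr; exact inter_subset_left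

section Brenier

variable {R : ℝ}

/-- The Legendre transform over the closed ball of radius `R`. -/
def legendre (a : Metric.closedBall (0 : E2) R →ᵇ ℝ) (y : E2) : ℝ :=
  ⨆ x : Metric.closedBall (0 : E2) R, (⟪(x : E2), y⟫ - a x)

variable (a b : Metric.closedBall (0 : E2) R →ᵇ ℝ)

lemma inner_sub_le_legendre (x : Metric.closedBall (0 : E2) R) (y : E2) :
    ⟪(x : E2), y⟫ - a x ≤ legendre a y := by
  have hcont : Continuous fun x : Metric.closedBall (0 : E2) R => ⟪(x : E2), y⟫ - a x := by
    fun_prop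
  exact le_ciSup (isCompact_range hcont).bddAbove x

lemma exists_legendre_eq (hR : 0 ≤ R) (y : E2) :
    ∃ x : Metric.closedBall (0 : E2) R, legendre a y = ⟪(x : E2), y⟫ - a x := by
  have hcont : Continuous fun x : Metric.closedBall (0 : E2) R => ⟪(x : E2), y⟫ - a x := by
    fun_prop
  have : Nonempty (Metric.closedBall (0 : E2) R) := ⟨0, by simpa using hR⟩
  obtain ⟨x, -, hx⟩ := isCompact_univ.exists_isMaxOn (univ_nonempty) hcont.continuousOn
  exact ⟨x, le_antisymm (ciSup_le fun x' => hx (mem_univ x')) (inner_sub_le_legendre a x y)⟩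

lemma legendre_subgradient {x : Metric.closedBall (0 : E2) R} {y : E2}
    (hx : legendre a y = ⟪(x : E2), y⟫ - a x) (y' : E2) :
    legendre a y + ⟪(x : E2), y' - y⟫ ≤ legendre a y' := by
  rw [hx, inner_sub_right]
  linarith [inner_sub_le_legendre a x y']

lemma legendre_convexOn (hR : 0 ≤ R) : ConvexOn ℝ univ (legendre a) := by
  refine ⟨convex_univ, fun y₁ _ y₂ _ s t hs ht hst => ?_⟩
  obtain ⟨x, hx⟩ := exists_legendre_eq a hR (s • y₁ + t • y₂)
  rw [hx, inner_add_right, inner_smul_right, inner_smul_right, smul_eq_mul, smul_eq_mul]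
  have h1 := mul_le_mul_of_nonneg_left (inner_sub_le_legendre a x y₁) hs
  have h2 := mul_le_mul_of_nonneg_left (inner_sub_le_legendre a x y₂) ht
  have h3 : a x = s * a x + t * a x := by rw [← add_mul, hst, one_mul]
  linarith

lemma legendre_lipschitz (hR : 0 ≤ R) : LipschitzWith R.toNNReal (legendre a) := by
  refine LipschitzWith.of_le_add_mul _ fun y y' => ?_
  obtain ⟨x, hx⟩ := exists_legendre_eq a hR y
  have h1 := legendre_subgradient a hx y'
  have h2 := real_inner_le_norm (x : E2) (y - y')
  have h3 : ‖(x : E2)‖ ≤ R := mem_closedBall_zero_iff.1 x.2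
  have h4 := mul_le_mul_of_nonneg_right h3 (norm_nonneg (y - y'))
  rw [Real.coe_toNNReal _ hR, dist_eq_norm]
  rw [← neg_sub y y', inner_neg_right] at h1
  linarith

/-- The Legendre transform, restricted to the ball. -/
def legendreBall (hR : 0 ≤ R) : Metric.closedBall (0 : E2) R →ᵇ ℝ :=
  BoundedContinuousFunction.mkOfCompact
    ⟨fun y => legendre a y, (legendre_lipschitz a hR).continuous.comp continuous_subtype_val⟩

lemma legendreBall_apply {hR : 0 ≤ R} (y : Metric.closedBall (0 : E2) R) :
    legendreBall a hR y = legendre a y := rfl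

lemma legendre_le_add (hR : 0 ≤ R) {c : ℝ} (h : ∀ x, b x ≤ a x + c) (y : E2) :
    legendre a y ≤ legendre b y + c := by
  obtain ⟨x, hx⟩ := exists_legendre_eq a hR y
  linarith [inner_sub_le_legendre b x y, h x]

lemma legendreBall_legendreBall_le (hR : 0 ≤ R) (x : Metric.closedBall (0 : E2) R) :
    legendreBall (legendreBall a hR) hR x ≤ a x := by
  rw [legendreBall_apply]
  obtain ⟨y, hy⟩ := exists_legendre_eq (legendreBall a hR) hR (x : E2)
  rw [hy, legendreBall_apply, real_inner_comm]
  linarith [inner_sub_le_legendre a x (y : E2)]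

/-- The dual functional of the Kantorovich problem. -/
def dualCost (hR : 0 ≤ R) (μ ν : Measure (Metric.closedBall (0 : E2) R)) : ℝ :=
  ∫ x, a x ∂μ + ∫ y, legendreBall a hR y ∂ν

variable (μ ν : Measure (Metric.closedBall (0 : E2) R)) [IsFiniteMeasure μ] [IsFiniteMeasure ν]

lemma dualCost_legendre_le (hR : 0 ≤ R) :
    dualCost (legendreBall (legendreBall a hR) hR) hR μ ν ≤ dualCost a hR μ ν := by
  refine add_le_add (integral_mono (BoundedContinuousFunction.integrable _ _)
    (BoundedContinuousFunction.integrable _ _) fun x => legendreBall_legendreBall_le a hR x)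
    (integral_mono (BoundedContinuousFunction.integrable _ _)
    (BoundedContinuousFunction.integrable _ _) fun x =>
      legendreBall_legendreBall_le (legendreBall a hR) hR x)

lemma dualCost_shift (hR : 0 ≤ R) (hmass : μ univ = ν univ) (c : ℝ) :
    dualCost (a + BoundedContinuousFunction.const _ c) hR μ ν = dualCost a hR μ ν := by
  have h1 : ∀ y, legendreBall (a + BoundedContinuousFunction.const _ c) hR y
      = legendreBall a hR y - c := by
    intro y
    refine le_antisymm ?_ ?_
    · have := legendre_le_add (a + BoundedContinuousFunction.const _ c) a hR (c := -c)
        (by simp) (y : E2)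
      simpa [legendreBall_apply, sub_eq_add_neg] using this
    · have := legendre_le_add a (a + BoundedContinuousFunction.const _ c) hR (c := c)
        (by simp) (y : E2)
      simpa [legendreBall_apply] using this
  unfold dualCost
  simp only [h1, BoundedContinuousFunction.coe_add, Pi.add_apply,
    BoundedContinuousFunction.const_apply]
  rw [integral_add (a.integrable μ) (integrable_const c),
    integral_sub ((legendreBall a hR).integrable ν) (integrable_const c)]
  simp [measureReal_def, hmass]

lemma continuous_dualCost (hR : 0 ≤ R) : Continuous fun a => dualCost a hR μ ν := by
  have h : ∀ a b : Metric.closedBall (0 : E2) R →ᵇ ℝ,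
      dualCost a hR μ ν ≤ dualCost b hR μ ν + (μ.real univ + ν.real univ) * dist a b := by
    intro a b
    have h1 : ∀ x, a x ≤ b x + dist a b := fun x => by
      have := BoundedContinuousFunction.dist_coe_le_dist (f := a) (g := b) x
      rw [Real.dist_eq] at this
      linarith [le_abs_self (a x - b x)]
    have h2 : ∀ x, b x ≤ a x + dist a b := fun x => by
      have := BoundedContinuousFunction.dist_coe_le_dist (f := a) (g := b) x
      rw [Real.dist_eq] at this
      linarith [neg_abs_le (a x - b x)]
    have h3 : ∫ x, a x ∂μ ≤ ∫ x, (b x + dist a b) ∂μ :=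
      integral_mono (a.integrable _) ((b.integrable _).add (integrable_const _)) h1
    have h4 : ∫ x, legendreBall a hR x ∂ν ≤ ∫ x, (legendreBall b hR x + dist a b) ∂ν :=
      integral_mono ((legendreBall a hR).integrable _)
        (((legendreBall b hR).integrable _).add (integrable_const _))
        fun y => legendre_le_add a b hR h2 y
    rw [integral_add (b.integrable μ) (integrable_const _)] at h3
    rw [integral_add ((legendreBall b hR).integrable ν) (integrable_const _)] at h4
    simp only [integral_const, smul_eq_mul] at h3 h4
    unfold dualCost
    linarith
  refine (LipschitzWith.of_le_add_mul (μ.real univ + ν.real univ).toNNReal fun a b => ?_).continuous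
  rw [Real.coe_toNNReal _ (by positivity)]
  exact h a b

lemma exists_dualCost_minimizer (hR : 0 ≤ R) (hmass : μ univ = ν univ) :
    ∃ a, ∀ b, dualCost a hR μ ν ≤ dualCost b hR μ ν := by
  let o : Metric.closedBall (0 : E2) R := ⟨0, by simpa using hR⟩
  let S : Set (Metric.closedBall (0 : E2) R →ᵇ ℝ) :=
    {a | a o = 0 ∧ LipschitzWith R.toNNReal a}
  have hS : IsCompact S := by
    refine BoundedContinuousFunction.arzela_ascoli₂ (Metric.closedBall (0 : ℝ) (R * R))
      (isCompact_closedBall _ _) S ?_ ?_ ?_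
    · have h1 : IsClosed {a : Metric.closedBall (0 : E2) R →ᵇ ℝ | a o = 0} :=
        isClosed_eq (by fun_prop) continuous_const
      have h2 : IsClosed {a : Metric.closedBall (0 : E2) R →ᵇ ℝ | LipschitzWith R.toNNReal a} := by
        simp only [lipschitzWith_iff_dist_le_mul, ofPred_forall]
        exact isClosed_iInter fun x => isClosed_iInter fun y =>
          isClosed_le (by fun_prop) continuous_const
      exact h1.inter h2
    · intro a x ha
      have h1 := ha.2.dist_le_mul x o
      rw [ha.1, Real.coe_toNNReal _ hR] at h1
      refine h1.trans (mul_le_mul_of_nonneg_left ?_ hR)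
      exact x.2
    · exact (LipschitzWith.uniformEquicontinuous _ R.toNNReal fun a => a.2.2).equicontinuous
  obtain ⟨a, haS, ha⟩ := hS.exists_isMinOn ⟨0, by simp,
    LipschitzWith.const' (0 : ℝ)⟩ (continuous_dualCost μ ν hR).continuousOn
  refine ⟨a, fun b => ?_⟩
  set b' := legendreBall (legendreBall b hR) hR with hb'
  refine le_trans ?_ (dualCost_legendre_le b μ ν hR)
  rw [← dualCost_shift b' μ ν hR hmass (-(b' o))]
  refine ha ⟨by simp, ?_⟩
  have := ((legendre_lipschitz (legendreBall b hR) hR).comp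
    (LipschitzWith.subtype_val (Metric.closedBall (0 : E2) R))).add
    (LipschitzWith.const (-(b' o)))
  rw [add_zero, mul_one] at this
  exact this

end Brenier

section EulerLagrange

variable {R : ℝ}

variable (a h : Metric.closedBall (0 : E2) R →ᵇ ℝ)

lemma gradient_legendre {x : Metric.closedBall (0 : E2) R} {y : E2}
    (hx : legendre a y = ⟪(x : E2), y⟫ - a x) (hd : DifferentiableAt ℝ (legendre a) y) :
    gradient (legendre a) y = x := by
  have hmin : IsLocalMin (fun y' => legendre a y' - ⟪(x : E2), y'⟫) y := by
    refine Eventually.of_forall fun y' => ?_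
    have := legendre_subgradient a hx y'
    rw [inner_sub_right] at this
    linarith
  have h1 : HasFDerivAt (fun y' => legendre a y' - ⟪(x : E2), y'⟫)
      (fderiv ℝ (legendre a) y - innerSL ℝ (x : E2)) y :=
    hd.hasFDerivAt.sub (innerSL ℝ (x : E2)).hasFDerivAt
  have h2 := sub_eq_zero.1 (hmin.hasFDerivAt_eq_zero h1)
  rw [gradient, h2]
  exact (InnerProductSpace.toDual ℝ E2).symm_apply_apply _

lemma tendsto_legendre_quotient (hR : 0 ≤ R) {x : Metric.closedBall (0 : E2) R} {y : E2}
    (hx : legendre a y = ⟪(x : E2), y⟫ - a x) (hd : DifferentiableAt ℝ (legendre a) y) :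
    Tendsto (fun n : ℕ => ((n : ℝ) + 1) * (legendre (a + ((n : ℝ) + 1)⁻¹ • h) y - legendre a y))
      atTop (𝓝 (-h x)) := by
  choose X hX using fun n : ℕ => exists_legendre_eq (a + ((n : ℝ) + 1)⁻¹ • h) hR y
  have hpos : ∀ n : ℕ, (0 : ℝ) < n + 1 := fun n => by positivity
  have hlow : ∀ n : ℕ, legendre a y - 2 * ‖h‖ * ((n : ℝ) + 1)⁻¹ ≤ ⟪(X n : E2), y⟫ - a (X n) := by
    intro n
    have h1 := inner_sub_le_legendre (a + ((n : ℝ) + 1)⁻¹ • h) x y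
    rw [hX n] at h1
    simp only [BoundedContinuousFunction.coe_add, BoundedContinuousFunction.coe_smul,
      Pi.add_apply, smul_eq_mul] at h1
    have h2 := abs_le.1 (h.norm_coe_le_norm x)
    have h3 := abs_le.1 (h.norm_coe_le_norm (X n))
    have h4 := inv_pos.2 (hpos n)
    nlinarith
  have hX' : Tendsto X atTop (𝓝 x) := by
    refine isCompact_univ.tendsto_nhds_of_unique_mapClusterPt (by simp) fun z _ hz => ?_
    have hcont : Continuous fun x : Metric.closedBall (0 : E2) R => ⟪(x : E2), y⟫ - a x := by
      fun_prop
    have h1 := hz.continuousAt_comp hcont.continuousAt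
    have h2 : Tendsto ((fun x : Metric.closedBall (0 : E2) R => ⟪(x : E2), y⟫ - a x) ∘ X) atTop
        (𝓝 (legendre a y)) := by
      refine tendsto_of_tendsto_of_tendsto_of_le_of_le (g := fun n : ℕ =>
        legendre a y - 2 * ‖h‖ * ((n : ℝ) + 1)⁻¹) ?_ tendsto_const_nhds hlow
        fun n => inner_sub_le_legendre a (X n) y
      have h3 : Tendsto (fun n : ℕ => ((n : ℝ) + 1)⁻¹) atTop (𝓝 0) := by
        simpa using tendsto_one_div_add_atTop_nhds_zero_nat (𝕜 := ℝ)
      simpa using (h3.const_mul (2 * ‖h‖)).const_sub (legendre a y)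
    have h3 : legendre a y = ⟪(z : E2), y⟫ - a z :=
      (eq_of_nhds_neBot ((show ClusterPt _ _ from h1).neBot.mono
        (inf_le_inf_left _ h2))).symm
    apply Subtype.ext
    rw [← gradient_legendre a h3 hd, ← gradient_legendre a hx hd]
  refine tendsto_of_tendsto_of_tendsto_of_le_of_le (h := fun n => -h (X n)) tendsto_const_nhds
    ((h.continuous.tendsto x).comp hX').neg (fun n => ?_) (fun n => ?_)
  · have h1 := inner_sub_le_legendre (a + ((n : ℝ) + 1)⁻¹ • h) x y
    simp only [BoundedContinuousFunction.coe_add, BoundedContinuousFunction.coe_smul,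
      Pi.add_apply, smul_eq_mul] at h1
    have h2 := mul_le_mul_of_nonneg_left (show -(((n : ℝ) + 1)⁻¹ * h x) ≤
      legendre (a + ((n : ℝ) + 1)⁻¹ • h) y - legendre a y by linarith) (hpos n).le
    rw [mul_neg, mul_inv_cancel_left₀ (hpos n).ne'] at h2
    exact h2
  · have h1 := inner_sub_le_legendre a (X n) y
    have h3 := hX n
    simp only [BoundedContinuousFunction.coe_add, BoundedContinuousFunction.coe_smul,
      Pi.add_apply, smul_eq_mul] at h3
    have h2 := mul_le_mul_of_nonneg_left (show
      legendre (a + ((n : ℝ) + 1)⁻¹ • h) y - legendre a y ≤ -(((n : ℝ) + 1)⁻¹ * h (X n))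
      by linarith) (hpos n).le
    rw [mul_neg, mul_inv_cancel_left₀ (hpos n).ne'] at h2
    exact h2

variable (μ ν : Measure (Metric.closedBall (0 : E2) R)) [IsFiniteMeasure μ] [IsFiniteMeasure ν]

lemma integral_le_of_dualCost_minimizer (hR : 0 ≤ R)
    (hmin : ∀ b, dualCost a hR μ ν ≤ dualCost b hR μ ν)
    (hd : ∀ᵐ y : Metric.closedBall (0 : E2) R ∂ν, DifferentiableAt ℝ (legendre a) (y : E2))
    {F : Metric.closedBall (0 : E2) R → ℝ}
    (hF : ∀ᵐ y : Metric.closedBall (0 : E2) R ∂ν, ∃ x : Metric.closedBall (0 : E2) R,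
      legendre a (y : E2) = ⟪(x : E2), (y : E2)⟫ - a x ∧ F y = h x) :
    ∫ y, F y ∂ν ≤ ∫ x, h x ∂μ := by
  have hpos : ∀ n : ℕ, (0 : ℝ) < n + 1 := fun n => by positivity
  set D : ℕ → Metric.closedBall (0 : E2) R → ℝ := fun n y =>
    ((n : ℝ) + 1) * (legendreBall (a + ((n : ℝ) + 1)⁻¹ • h) hR y - legendreBall a hR y) with hD
  have hlim : Tendsto (fun n => ∫ y, D n y ∂ν) atTop (𝓝 (∫ y, -F y ∂ν)) := by
    refine tendsto_integral_of_dominated_convergence (fun _ => ‖h‖) (fun n => ?_)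
      (integrable_const _) (fun n => ?_) ?_
    · exact (Continuous.aestronglyMeasurable (by fun_prop))
    · refine Eventually.of_forall fun y => ?_
      have hb : ∀ x, |((n : ℝ) + 1)⁻¹ * h x| ≤ ((n : ℝ) + 1)⁻¹ * ‖h‖ := fun x => by
        rw [abs_mul, abs_of_pos (inv_pos.2 (hpos n))]
        exact mul_le_mul_of_nonneg_left (h.norm_coe_le_norm x) (inv_pos.2 (hpos n)).le
      have h1 := legendre_le_add (a + ((n : ℝ) + 1)⁻¹ • h) a hR
        (c := ((n : ℝ) + 1)⁻¹ * ‖h‖) (fun x => by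
          simp only [BoundedContinuousFunction.coe_add, BoundedContinuousFunction.coe_smul,
            Pi.add_apply, smul_eq_mul]
          linarith [(abs_le.1 (hb x)).1]) (y : E2)
      have h2 := legendre_le_add a (a + ((n : ℝ) + 1)⁻¹ • h) hR
        (c := ((n : ℝ) + 1)⁻¹ * ‖h‖) (fun x => by
          simp only [BoundedContinuousFunction.coe_add, BoundedContinuousFunction.coe_smul,
            Pi.add_apply, smul_eq_mul]
          linarith [(abs_le.1 (hb x)).2]) (y : E2)
      have h3 : |legendre (a + ((n : ℝ) + 1)⁻¹ • h) y - legendre a y| ≤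
        ((n : ℝ) + 1)⁻¹ * ‖h‖ := abs_le.2 ⟨by linarith, by linarith⟩
      rw [hD, Real.norm_eq_abs, abs_mul, abs_of_pos (hpos n)]
      refine (mul_le_mul_of_nonneg_left h3 (hpos n).le).trans_eq ?_
      rw [mul_inv_cancel_left₀ (hpos n).ne']
    · filter_upwards [hd, hF] with y hdy ⟨x, hx, hFx⟩
      rw [hFx]
      exact tendsto_legendre_quotient a h hR hx hdy
  have hge : ∀ n, -∫ x, h x ∂μ ≤ ∫ y, D n y ∂ν := by
    intro n
    have h1 := hmin (a + ((n : ℝ) + 1)⁻¹ • h)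
    unfold dualCost at h1
    simp only [BoundedContinuousFunction.coe_add, BoundedContinuousFunction.coe_smul,
      Pi.add_apply, smul_eq_mul] at h1
    rw [integral_add (a.integrable μ) ((h.integrable μ).const_mul _), integral_const_mul] at h1
    rw [hD, integral_const_mul, integral_sub (BoundedContinuousFunction.integrable _ _)
      (BoundedContinuousFunction.integrable _ _)]
    have h2 := mul_le_mul_of_nonneg_left (show -(((n : ℝ) + 1)⁻¹ * ∫ x, h x ∂μ) ≤
      ∫ y, legendreBall (a + ((n : ℝ) + 1)⁻¹ • h) hR y ∂ν - ∫ y, legendreBall a hR y ∂ν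
      by linarith) (hpos n).le
    rw [mul_neg, mul_inv_cancel_left₀ (hpos n).ne'] at h2
    exact h2
  have := ge_of_tendsto' hlim hge
  rw [integral_neg] at this
  linarith

lemma integral_eq_of_dualCost_minimizer (hR : 0 ≤ R)
    (hmin : ∀ b, dualCost a hR μ ν ≤ dualCost b hR μ ν)
    (hd : ∀ᵐ y : Metric.closedBall (0 : E2) R ∂ν, DifferentiableAt ℝ (legendre a) (y : E2))
    {F : Metric.closedBall (0 : E2) R → ℝ}
    (hF : ∀ᵐ y : Metric.closedBall (0 : E2) R ∂ν, ∃ x : Metric.closedBall (0 : E2) R,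
      legendre a (y : E2) = ⟪(x : E2), (y : E2)⟫ - a x ∧ F y = h x) :
    ∫ y, F y ∂ν = ∫ x, h x ∂μ := by
  refine le_antisymm (integral_le_of_dualCost_minimizer a h μ ν hR hmin hd hF) ?_
  have := integral_le_of_dualCost_minimizer a (-h) μ ν hR hmin hd (F := fun y => -F y) (by
    filter_upwards [hF] with y ⟨x, hx, hFx⟩
    exact ⟨x, hx, by simp [hFx]⟩)
  simp only [BoundedContinuousFunction.coe_neg, Pi.neg_apply, integral_neg] at this
  linarith

end EulerLagrange

lemma integrable_of_continuous_of_ae_mem {X F : Type*} [TopologicalSpace X] [MeasurableSpace X]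
    [OpensMeasurableSpace X] [NormedAddCommGroup F] [SecondCountableTopologyEither X F]
    {μ : Measure X} [IsFiniteMeasure μ] {f : X → F} (hf : Continuous f) {K : Set X}
    (hK : IsCompact K) (hμ : ∀ᵐ x ∂μ, x ∈ K) : Integrable f μ := by
  obtain ⟨C, hC⟩ := hK.exists_bound_of_continuousOn hf.continuousOn
  exact Integrable.of_bound hf.aestronglyMeasurable C (hμ.mono hC)

lemma ae_fst_mem_of_map {μ : Measure E2} {γ : Measure (E2 × E2)} (h : γ.map Prod.fst = μ)
    {s : Set E2} (hμ : ∀ᵐ x ∂μ, x ∈ s) : ∀ᵐ p ∂γ, p.1 ∈ s := by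
  rw [← h] at hμ
  exact ae_of_ae_map measurable_fst.aemeasurable hμ

lemma ae_snd_mem_of_map {μ : Measure E2} {γ : Measure (E2 × E2)} (h : γ.map Prod.snd = μ)
    {s : Set E2} (hμ : ∀ᵐ x ∂μ, x ∈ s) : ∀ᵐ p ∂γ, p.2 ∈ s := by
  rw [← h] at hμ
  exact ae_of_ae_map measurable_snd.aemeasurable hμ

/-- **Brenier's theorem** in a ball: an absolutely continuous measure is transported optimally
by the gradient of a convex function. -/
theorem exists_brenier_map {R : ℝ} (hR : 0 ≤ R) {μ ν : Measure E2} [IsFiniteMeasure μ]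
    [IsFiniteMeasure ν] (hmass : μ univ = ν univ)
    (hμ : ∀ᵐ x ∂μ, x ∈ Metric.closedBall (0 : E2) R)
    (hν : ∀ᵐ x ∂ν, x ∈ Metric.closedBall (0 : E2) R) (hac : ν ≪ volume) :
    ∃ (v : E2 → ℝ) (T : E2 → E2), ConvexOn ℝ univ v ∧ Continuous v ∧ Measurable T ∧
      (∀ᵐ y ∂ν, T y ∈ Metric.closedBall (0 : E2) R) ∧
      (∀ᵐ y ∂ν, ∀ y', v y + ⟪T y, y' - y⟫ ≤ v y') ∧ ν.map T = μ ∧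
      ∀ γ : Measure (E2 × E2), γ.map Prod.fst = μ → γ.map Prod.snd = ν →
        ∫ y, ‖T y - y‖ ^ 2 ∂ν ≤ ∫ p, ‖p.1 - p.2‖ ^ 2 ∂γ := by
  have hBm : MeasurableSet (Metric.closedBall (0 : E2) R) := measurableSet_closedBall
  set μ' : Measure (Metric.closedBall (0 : E2) R) := μ.comap Subtype.val with hμ'
  set ν' : Measure (Metric.closedBall (0 : E2) R) := ν.comap Subtype.val with hν'
  have huniv : ∀ m : Measure E2, (∀ᵐ x ∂m, x ∈ Metric.closedBall (0 : E2) R) →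
      (m.comap Subtype.val : Measure (Metric.closedBall (0 : E2) R)) univ = m univ := by
    intro m hm
    rw [(MeasurableEmbedding.subtype_coe hBm).comap_apply, image_univ, Subtype.range_coe]
    conv_rhs => rw [← Measure.restrict_eq_self_of_ae_mem hm]
    rw [Measure.restrict_apply_univ]
  have hint : ∀ (m : Measure E2), (∀ᵐ x ∂m, x ∈ Metric.closedBall (0 : E2) R) →
      ∀ f : E2 → ℝ, ∫ x : Metric.closedBall (0 : E2) R, f x ∂(m.comap Subtype.val)
        = ∫ x, f x ∂m := by
    intro m hm f
    rw [integral_subtype_comap hBm, Measure.restrict_eq_self_of_ae_mem hm]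
  have : IsFiniteMeasure μ' := ⟨by rw [hμ', huniv μ hμ]; exact measure_lt_top _ _⟩
  have : IsFiniteMeasure ν' := ⟨by rw [hν', huniv ν hν]; exact measure_lt_top _ _⟩
  obtain ⟨a, ha⟩ := exists_dualCost_minimizer μ' ν' hR (by rw [huniv μ hμ, huniv ν hν, hmass])
  have hvc : Continuous (legendre a) := (legendre_lipschitz a hR).continuous
  have hdiff : ∀ᵐ y ∂ν, DifferentiableAt ℝ (legendre a) y :=
    hac (legendre_lipschitz a hR).ae_differentiableAt
  have hdiff' : ∀ᵐ y : Metric.closedBall (0 : E2) R ∂ν',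
      DifferentiableAt ℝ (legendre a) (y : E2) := by
    refine ae_of_ae_map (f := Subtype.val) measurable_subtype_coe.aemeasurable ?_
    rw [hν', (MeasurableEmbedding.subtype_coe hBm).map_comap]
    exact ae_restrict_of_ae hdiff
  have hTm : Measurable (gradient (legendre a)) :=
    (InnerProductSpace.toDual ℝ E2).symm.continuous.measurable.comp (measurable_fderiv ℝ _)
  have hT : ∀ᵐ y ∂ν, ∃ x : Metric.closedBall (0 : E2) R,
      legendre a y = ⟪(x : E2), y⟫ - a x ∧ gradient (legendre a) y = x := by
    filter_upwards [hdiff] with y hy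
    obtain ⟨x, hx⟩ := exists_legendre_eq a hR y
    exact ⟨x, hx, gradient_legendre a hx hy⟩
  have hTB : ∀ᵐ y ∂ν, gradient (legendre a) y ∈ Metric.closedBall (0 : E2) R := by
    filter_upwards [hT] with y ⟨x, hx, hxy⟩
    rw [hxy]
    exact x.2
  have hmap : ν.map (gradient (legendre a)) = μ := by
    refine ext_of_forall_integral_eq_of_IsFiniteMeasure fun f => ?_
    rw [integral_map hTm.aemeasurable (by fun_prop)]
    have h1 := integral_eq_of_dualCost_minimizer a
      (f.compContinuous ⟨Subtype.val, continuous_subtype_val⟩) μ' ν' hR ha hdiff'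
      (F := fun y => f (gradient (legendre a) y)) (by
        filter_upwards [hdiff'] with y hy
        obtain ⟨x, hx⟩ := exists_legendre_eq a hR (y : E2)
        exact ⟨x, hx, by simp [gradient_legendre a hx hy]⟩)
    rw [hint ν hν (fun y => f (gradient (legendre a) y))] at h1
    rw [h1]
    exact hint μ hμ f
  refine ⟨legendre a, gradient (legendre a), legendre_convexOn a hR, hvc, hTm, hTB, ?_, hmap, ?_⟩
  · filter_upwards [hT] with y ⟨x, hx, hxy⟩
    rw [hxy]
    exact legendre_subgradient a hx
  intro γ h1 h2
  set T := gradient (legendre a) with hTdef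
  have hBc := isCompact_closedBall (0 : E2) R
  have : IsFiniteMeasure γ := by
    refine ⟨?_⟩
    have : γ univ = μ univ := by rw [← h1, Measure.map_apply measurable_fst .univ, preimage_univ]
    rw [this]
    exact measure_lt_top _ _
  have hγ1 := ae_fst_mem_of_map h1 hμ
  have hγ2 := ae_snd_mem_of_map h2 hν
  have hγ : ∀ᵐ p ∂γ, p ∈ Metric.closedBall (0 : E2) R ×ˢ Metric.closedBall (0 : E2) R := by
    filter_upwards [hγ1, hγ2] with p h h' using ⟨h, h'⟩
  set b := legendre (legendreBall a hR) with hb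
  have hbc : Continuous b := (legendre_lipschitz _ hR).continuous
  have iγ : ∀ {F : E2 × E2 → ℝ}, Continuous F → Integrable F γ := fun hF =>
    integrable_of_continuous_of_ae_mem hF (hBc.prod hBc) hγ
  have iμ : ∀ {F : E2 → ℝ}, Continuous F → Integrable F μ := fun hF =>
    integrable_of_continuous_of_ae_mem hF hBc hμ
  have iν : ∀ {F : E2 → ℝ}, Continuous F → Integrable F ν := fun hF =>
    integrable_of_continuous_of_ae_mem hF hBc hν
  have iT : ∀ {F : E2 × E2 → ℝ}, Continuous F → Integrable (fun y => F (T y, y)) ν := by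
    intro F hF
    obtain ⟨C, hC⟩ := (hBc.prod hBc).exists_bound_of_continuousOn hF.continuousOn
    refine Integrable.of_bound (hF.measurable.comp
      (hTm.prodMk measurable_id)).aestronglyMeasurable C ?_
    filter_upwards [hTB, hν] with y hy hy'
    exact hC _ ⟨hy, hy'⟩
  have eμ : ∀ {F : E2 → ℝ}, Continuous F → ∫ p, F p.1 ∂γ = ∫ y, F (T y) ∂ν := by
    intro F hF
    rw [← integral_map hTm.aemeasurable hF.aestronglyMeasurable, hmap, ← h1,
      integral_map measurable_fst.aemeasurable hF.aestronglyMeasurable]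
  have eν : ∀ {F : E2 → ℝ}, Continuous F → ∫ p, F p.2 ∂γ = ∫ y, F y ∂ν := by
    intro F hF
    conv_rhs => rw [← h2]
    rw [integral_map measurable_snd.aemeasurable hF.aestronglyMeasurable]
  have hinner : ∫ p, ⟪p.1, p.2⟫ ∂γ ≤ ∫ y, ⟪T y, y⟫ ∂ν := by
    calc ∫ p, ⟪p.1, p.2⟫ ∂γ ≤ ∫ p, (b p.1 + legendre a p.2) ∂γ := by
          refine integral_mono_ae (iγ (by fun_prop)) (iγ (by fun_prop)) ?_
          filter_upwards [hγ2] with p hp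
          have := inner_sub_le_legendre (legendreBall a hR) ⟨p.2, hp⟩ p.1
          rw [legendreBall_apply, real_inner_comm] at this
          simp only at this
          linarith
      _ = ∫ y, (b (T y) + legendre a y) ∂ν := by
          rw [integral_add (iγ (by fun_prop)) (iγ (by fun_prop)), eμ hbc, eν hvc,
            ← integral_add (iT (F := fun p => b p.1) (by fun_prop)) (iν hvc)]
      _ ≤ ∫ y, ⟪T y, y⟫ ∂ν := by
          refine integral_mono_ae (iT (F := fun p => b p.1 + legendre a p.2) (by fun_prop))
            (iT (F := fun p => ⟪p.1, p.2⟫) (by fun_prop)) ?_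
          filter_upwards [hT] with y ⟨x, hx, hxy⟩
          have := legendreBall_legendreBall_le a hR x
          rw [legendreBall_apply] at this
          rw [hxy]
          linarith
  have e1 : ∫ y, ‖T y - y‖ ^ 2 ∂ν
      = ∫ y, ‖T y‖ ^ 2 ∂ν - 2 * ∫ y, ⟪T y, y⟫ ∂ν + ∫ y, ‖y‖ ^ 2 ∂ν := by
    simp only [norm_sub_sq_real]
    rw [integral_add (iT (F := fun p => ‖p.1‖ ^ 2 - 2 * ⟪p.1, p.2⟫) (by fun_prop))
      (iν (by fun_prop)), integral_sub (iT (F := fun p => ‖p.1‖ ^ 2) (by fun_prop))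
      (iT (F := fun p => 2 * ⟪p.1, p.2⟫) (by fun_prop)), integral_const_mul]
  have e2 : ∫ p, ‖p.1 - p.2‖ ^ 2 ∂γ
      = ∫ p, ‖p.1‖ ^ 2 ∂γ - 2 * ∫ p, ⟪p.1, p.2⟫ ∂γ + ∫ p, ‖p.2‖ ^ 2 ∂γ := by
    simp only [norm_sub_sq_real]
    rw [integral_add (iγ (by fun_prop)) (iγ (by fun_prop)), integral_sub (iγ (by fun_prop))
      (iγ (by fun_prop)), integral_const_mul]
  rw [e1, e2, eμ (F := fun x => ‖x‖ ^ 2) (by fun_prop), eν (F := fun x => ‖x‖ ^ 2) (by fun_prop)]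
  linarith

lemma integral_norm_mul_norm_le_sqrt {X : Type*} [MeasurableSpace X] {m : Measure X}
    {F H : X → E2} (hF : AEStronglyMeasurable F m) (hH : AEStronglyMeasurable H m)
    (hF2 : Integrable (fun x => ‖F x‖ ^ 2) m) (hH2 : Integrable (fun x => ‖H x‖ ^ 2) m) :
    ∫ x, ‖F x‖ * ‖H x‖ ∂m ≤ √(∫ x, ‖F x‖ ^ 2 ∂m) * √(∫ x, ‖H x‖ ^ 2 ∂m) := by
  have h := integral_mul_le_Lp_mul_Lq_of_nonneg (μ := m) (p := 2) (q := 2)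
    Real.HolderConjugate.two_two (f := fun x => ‖F x‖) (g := fun x => ‖H x‖)
    (Eventually.of_forall fun x => norm_nonneg _) (Eventually.of_forall fun x => norm_nonneg _)
    (by
      rw [ENNReal.ofReal_ofNat]
      exact (memLp_two_iff_integrable_sq hF.norm).2 hF2)
    (by
      rw [ENNReal.ofReal_ofNat]
      exact (memLp_two_iff_integrable_sq hH.norm).2 hH2)
  simpa [Real.sqrt_eq_rpow] using h

/-- Integrating the increment of `ψ` against a coupling of two measures of density at most `M` is
controlled by the `L²` norm of the gradient and the quadratic cost. -/
theorem integral_sub_le_of_coupling {M : ℝ≥0} {R : ℝ} (hR : 0 ≤ R) {γ : Measure (E2 × E2)}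
    [IsFiniteMeasure γ] (hγ : ∀ᵐ p ∂γ, p.1 ∈ Metric.closedBall (0 : E2) R ∧
      p.2 ∈ Metric.closedBall (0 : E2) R)
    (h1 : γ.map Prod.fst ≤ (M : ℝ≥0∞) • volume) (h2 : γ.map Prod.snd ≤ (M : ℝ≥0∞) • volume)
    {ψ : E2 → ℝ} {G : E2 → E2} (hψ : ∀ z, HasGradientAt ψ (G z) z) (hG : Continuous G)
    (hL : Integrable (fun z => ‖G z‖ ^ 2)) :
    ∫ p, (ψ p.1 - ψ p.2) ∂γ ≤ √(M * ∫ z, ‖G z‖ ^ 2) * √(∫ p, ‖p.1 - p.2‖ ^ 2 ∂γ) := by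
  have hψc : Continuous ψ := continuous_iff_continuousAt.2 fun z => (hψ z).continuousAt
  have hBc := isCompact_closedBall (0 : E2) R
  set μ := γ.map Prod.fst with hμdef
  set ν := γ.map Prod.snd with hνdef
  have hμ : ∀ᵐ x ∂μ, x ∈ Metric.closedBall (0 : E2) R := by
    refine (ae_map_iff measurable_fst.aemeasurable measurableSet_closedBall).2 ?_
    exact hγ.mono fun p hp => hp.1
  have hν : ∀ᵐ x ∂ν, x ∈ Metric.closedBall (0 : E2) R := by
    refine (ae_map_iff measurable_snd.aemeasurable measurableSet_closedBall).2 ?_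
    exact hγ.mono fun p hp => hp.2
  have hmass : μ univ = ν univ := by
    rw [hμdef, hνdef, Measure.map_apply measurable_fst .univ, Measure.map_apply measurable_snd .univ,
      preimage_univ, preimage_univ]
  obtain ⟨v, T, hv, hvc, hTm, hTB, hsub, hmap, hcost⟩ := exists_brenier_map hR hmass hμ hν
    ((Measure.absolutelyContinuous_of_le h2).trans Measure.smul_absolutelyContinuous)
  have hcost := hcost γ rfl rfl
  set w : ℝ → E2 → E2 := fun t y => (1 - t) • T y + t • y with hw
  have hwm : ∀ t, Measurable (w t) := fun t => by fun_prop
  have hwB : ∀ᵐ y ∂ν, ∀ t ∈ Icc (0 : ℝ) 1, w t y ∈ Metric.closedBall (0 : E2) R := by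
    filter_upwards [hTB, hν] with y h h' t ht
    exact convex_closedBall (0 : E2) R h h' (by linarith [ht.2]) ht.1 (by ring)
  obtain ⟨Cψ, hCψ⟩ := hBc.exists_bound_of_continuousOn hψc.continuousOn
  obtain ⟨CG, hCG⟩ := hBc.exists_bound_of_continuousOn hG.continuousOn
  have hd2 : ∀ᵐ y ∂ν, ‖y - T y‖ ≤ 2 * R := by
    filter_upwards [hTB, hν] with y h h'
    have := norm_sub_le y (T y)
    rw [mem_closedBall_zero_iff] at h h'
    linarith
  have hderiv : ∀ y t, HasDerivAt (fun t => ψ (w t y)) ⟪G (w t y), y - T y⟫ t := by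
    intro y t
    have hwd : HasDerivAt (fun t => w t y) (y - T y) t := by
      have := (((hasDerivAt_id t).const_sub 1).smul_const (T y)).add
        ((hasDerivAt_id t).smul_const y)
      rw [neg_smul, one_smul, one_smul, neg_add_eq_sub] at this
      exact this
    exact (hψ (w t y)).hasFDerivAt.comp_hasDerivAt t hwd
  set j : ℝ → ℝ := fun t => ∫ y, ψ (w t y) ∂ν with hj
  have hjc : ContinuousOn j (Icc 0 1) := by
    refine continuousOn_of_dominated (bound := fun _ => Cψ)
      (fun t _ => (hψc.measurable.comp (hwm t)).aestronglyMeasurable) (fun t ht => ?_)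
      (integrable_const _) (Eventually.of_forall fun y => ?_)
    · filter_upwards [hwB] with y hy
      exact hCψ _ (hy t ht)
    · exact Continuous.continuousOn (by fun_prop)
  have hjd : ∀ t ∈ Ioo (0 : ℝ) 1, HasDerivAt j (∫ y, ⟪G (w t y), y - T y⟫ ∂ν) t := by
    intro t ht
    refine (hasDerivAt_integral_of_dominated_loc_of_deriv_le (bound := fun _ => CG * (2 * R))
      (F' := fun t y => ⟪G (w t y), y - T y⟫) (Ioo_mem_nhds ht.1 ht.2)
      (Eventually.of_forall fun t => (hψc.measurable.comp (hwm t)).aestronglyMeasurable) ?_ ?_ ?_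
      (integrable_const _) (Eventually.of_forall fun y s _ => hderiv y s)).2
    · refine Integrable.of_bound (hψc.measurable.comp (hwm t)).aestronglyMeasurable Cψ ?_
      filter_upwards [hwB] with y hy
      exact hCψ _ (hy t (Ioo_subset_Icc_self ht))
    · exact (Measurable.inner (hG.measurable.comp (hwm t))
        (measurable_id.sub hTm)).aestronglyMeasurable
    · filter_upwards [hwB, hd2] with y hy hy2 s hs
      refine (norm_inner_le_norm _ _).trans ?_
      have := hCG _ (hy s (Ioo_subset_Icc_self hs))
      exact mul_le_mul this hy2 (norm_nonneg _) ((norm_nonneg _).trans this)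
  have hbound : ∀ t ∈ Ioo (0 : ℝ) 1, |∫ y, ⟪G (w t y), y - T y⟫ ∂ν| ≤
      √(M * ∫ z, ‖G z‖ ^ 2) * √(∫ p, ‖p.1 - p.2‖ ^ 2 ∂γ) := by
    intro t ht
    have hGw : AEStronglyMeasurable (fun y => G (w t y)) ν :=
      (hG.measurable.comp (hwm t)).aestronglyMeasurable
    have hyT : AEStronglyMeasurable (fun y => y - T y) ν :=
      (measurable_id.sub hTm).aestronglyMeasurable
    have hmapw : ν.map (w t) ≤ (M : ℝ≥0∞) • volume :=
      map_displacement_le hR ht.1 ht.2 h2 hTm (hmap ▸ h1) hv hvc (hν.and hsub)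
    have i1 : Integrable (fun y => ‖G (w t y)‖ ^ 2) ν := by
      refine Integrable.of_bound (hGw.norm.pow 2) (CG ^ 2) ?_
      filter_upwards [hwB] with y hy
      rw [norm_pow, norm_norm]
      gcongr
      exact hCG _ (hy t (Ioo_subset_Icc_self ht))
    have i2 : Integrable (fun y => ‖y - T y‖ ^ 2) ν := by
      refine Integrable.of_bound (hyT.norm.pow 2) ((2 * R) ^ 2) ?_
      filter_upwards [hd2] with y hy
      rw [norm_pow, norm_norm]
      gcongr
    calc |∫ y, ⟪G (w t y), y - T y⟫ ∂ν| ≤ ∫ y, ‖G (w t y)‖ * ‖y - T y‖ ∂ν := by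
          refine norm_integral_le_of_norm_le (f := fun y => ⟪G (w t y), y - T y⟫) ?_
            (Eventually.of_forall fun y => norm_inner_le_norm _ _)
          refine Integrable.of_bound (hGw.norm.mul hyT.norm) (CG * (2 * R)) ?_
          filter_upwards [hwB, hd2] with y hy hy2
          have := hCG _ (hy t (Ioo_subset_Icc_self ht))
          rw [norm_mul, norm_norm, norm_norm]
          exact mul_le_mul this hy2 (norm_nonneg _) ((norm_nonneg _).trans this)
      _ ≤ √(∫ y, ‖G (w t y)‖ ^ 2 ∂ν) * √(∫ y, ‖y - T y‖ ^ 2 ∂ν) :=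
          integral_norm_mul_norm_le_sqrt hGw hyT i1 i2
      _ ≤ _ := by
          gcongr
          · rw [← integral_map (f := fun z => ‖G z‖ ^ 2) (hwm t).aemeasurable (by fun_prop)]
            refine (integral_mono_measure hmapw (Eventually.of_forall fun z => by positivity)
              (hL.smul_measure ENNReal.coe_ne_top)).trans_eq ?_
            rw [integral_smul_measure]
            simp
          · simpa only [norm_sub_rev] using hcost
  have hmv := (convex_Icc (0 : ℝ) 1).mul_sub_le_image_sub_of_le_deriv hjc (fun t ht => by
      rw [interior_Icc] at ht
      exact (hjd t ht).differentiableAt.differentiableWithinAt)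
    (C := -(√(M * ∫ z, ‖G z‖ ^ 2) * √(∫ p, ‖p.1 - p.2‖ ^ 2 ∂γ))) (fun t ht => by
      rw [interior_Icc] at ht
      rw [(hjd t ht).deriv]
      exact (abs_le.1 (hbound t ht)).1) 0 (by simp) 1 (by simp) zero_le_one
  have hBB : ∀ᵐ p ∂γ, p ∈ Metric.closedBall (0 : E2) R ×ˢ Metric.closedBall (0 : E2) R := hγ
  have hj0 : j 0 = ∫ p, ψ p.1 ∂γ := by
    simp only [hj, hw, sub_zero, one_smul, zero_smul, add_zero]
    rw [← integral_map hTm.aemeasurable hψc.aestronglyMeasurable, hmap, hμdef,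
      integral_map measurable_fst.aemeasurable hψc.aestronglyMeasurable]
  have hj1 : j 1 = ∫ p, ψ p.2 ∂γ := by
    simp only [hj, hw, sub_self, one_smul, zero_smul, zero_add]
    rw [hνdef, integral_map measurable_snd.aemeasurable hψc.aestronglyMeasurable]
  rw [integral_sub (integrable_of_continuous_of_ae_mem (by fun_prop) (hBc.prod hBc) hBB)
    (integrable_of_continuous_of_ae_mem (by fun_prop) (hBc.prod hBc) hBB), ← hj0, ← hj1]
  linarith

section Kernels

variable {ε : ℝ}

/-- The regularized fundamental solution of the Laplacian. -/
def regLog (ε : ℝ) (x : E2) : ℝ := (4 * π)⁻¹ * log (‖x‖ ^ 2 + ε ^ 2)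

/-- The gradient of `regLog`. -/
def regKernel (ε : ℝ) (x : E2) : E2 := (2 * π * (‖x‖ ^ 2 + ε ^ 2))⁻¹ • x

/-- The derivative of `regKernel`. -/
def regKernelDeriv (ε : ℝ) (x : E2) : E2 →L[ℝ] E2 :=
  (2 * π * (‖x‖ ^ 2 + ε ^ 2))⁻¹ • ContinuousLinearMap.id ℝ E2
    - (π * (‖x‖ ^ 2 + ε ^ 2) ^ 2)⁻¹ • (innerSL ℝ x).smulRight x

/-- The Laplacian of `regLog`, an approximation of the Dirac mass. -/
def regDelta (ε : ℝ) (x : E2) : ℝ := ε ^ 2 / (π * (‖x‖ ^ 2 + ε ^ 2) ^ 2)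

lemma hasGradientAt_regLog (hε : 0 < ε) (x : E2) :
    HasGradientAt (regLog ε) (regKernel ε x) x := by
  have hq : ‖x‖ ^ 2 + ε ^ 2 ≠ 0 := by positivity
  have h1 := (((hasStrictFDerivAt_norm_sq x).hasFDerivAt.add_const (ε ^ 2)).log hq).const_mul
    ((4 * π)⁻¹)
  rw [hasGradientAt_iff_hasFDerivAt]
  refine h1.congr_fderiv ?_
  ext v
  simp [regKernel]
  field_simp
  ring

lemma hasFDerivAt_regKernel (hε : 0 < ε) (x : E2) :
    HasFDerivAt (regKernel ε) (regKernelDeriv ε x) x := by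
  have hq : ‖x‖ ^ 2 + ε ^ 2 ≠ 0 := by positivity
  have hq' : 2 * π * (‖x‖ ^ 2 + ε ^ 2) ≠ 0 := by positivity
  have h1 : HasFDerivAt (fun x : E2 => 2 * π * (‖x‖ ^ 2 + ε ^ 2))
      ((2 * π) • ((2 : ℕ) • innerSL ℝ x)) x :=
    ((hasStrictFDerivAt_norm_sq x).hasFDerivAt.add_const (ε ^ 2)).const_mul (2 * π)
  have h2 := ((hasDerivAt_inv hq').comp_hasFDerivAt x h1).smul (hasFDerivAt_id x)
  refine h2.congr_fderiv ?_
  ext1 v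
  simp only [regKernelDeriv, add_apply,
    smul_apply, ContinuousLinearMap.smulRight_apply,
    ContinuousLinearMap.id_apply, Function.comp_apply, id, smul_smul, innerSL_apply_apply,
    sub_eq_add_neg]
  congr 2
  simp
  field_simp
  rw [smul_smul]
  congr 1
  ring

lemma continuous_regKernelDeriv (hε : 0 < ε) : Continuous (regKernelDeriv ε) := by
  have hq : ∀ x : E2, 2 * π * (‖x‖ ^ 2 + ε ^ 2) ≠ 0 := fun x => by positivity
  have hq' : ∀ x : E2, π * (‖x‖ ^ 2 + ε ^ 2) ^ 2 ≠ 0 := fun x => by positivity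
  have h1 : Continuous fun x : E2 => (innerSL ℝ x).smulRight x :=
    ((ContinuousLinearMap.smulRightL ℝ E2 E2).continuous.comp
      (innerSL ℝ).continuous).clm_apply continuous_id
  unfold regKernelDeriv
  exact ((Continuous.inv₀ (by fun_prop) hq).smul continuous_const).sub
    ((Continuous.inv₀ (by fun_prop) hq').smul h1)

lemma continuous_regKernel (hε : 0 < ε) : Continuous (regKernel ε) :=
  continuous_iff_continuousAt.2 fun x => (hasFDerivAt_regKernel hε x).continuousAt

lemma continuous_regLog (hε : 0 < ε) : Continuous (regLog ε) :=
  continuous_iff_continuousAt.2 fun x => (hasGradientAt_regLog hε x).continuousAt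

lemma continuous_regDelta (hε : 0 < ε) : Continuous (regDelta ε) := by
  unfold regDelta
  exact Continuous.div (by fun_prop) (by fun_prop) fun x => by positivity

lemma regDelta_nonneg (x : E2) : 0 ≤ regDelta ε x := by
  unfold regDelta
  positivity

lemma norm_regKernelDeriv_le (hε : 0 < ε) (x : E2) :
    ‖regKernelDeriv ε x‖ ≤ (‖x‖ ^ 2 + ε ^ 2)⁻¹ := by
  have hq : 0 < ‖x‖ ^ 2 + ε ^ 2 := by positivity
  have hpi := Real.pi_gt_three
  refine ContinuousLinearMap.opNorm_le_bound _ (by positivity) fun v => ?_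
  simp only [regKernelDeriv, sub_apply,
    smul_apply, ContinuousLinearMap.smulRight_apply,
    ContinuousLinearMap.id_apply, innerSL_apply_apply]
  refine (norm_sub_le _ _).trans ?_
  rw [norm_smul, norm_smul, norm_smul, Real.norm_of_nonneg (by positivity),
    Real.norm_of_nonneg (by positivity)]
  have h1 : ‖⟪x, v⟫‖ * ‖x‖ ≤ (‖x‖ ^ 2 + ε ^ 2) * ‖v‖ := by
    have := mul_le_mul_of_nonneg_right (norm_inner_le_norm (𝕜 := ℝ) x v) (norm_nonneg x)
    nlinarith [mul_nonneg (sq_nonneg ε) (norm_nonneg v)]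
  have h2 := mul_le_mul_of_nonneg_left h1
    (show 0 ≤ (π * (‖x‖ ^ 2 + ε ^ 2) ^ 2)⁻¹ by positivity)
  have h3 : (π * (‖x‖ ^ 2 + ε ^ 2) ^ 2)⁻¹ * ((‖x‖ ^ 2 + ε ^ 2) * ‖v‖)
      = π⁻¹ * ((‖x‖ ^ 2 + ε ^ 2)⁻¹ * ‖v‖) := by field_simp
  have h4 : (2 * π * (‖x‖ ^ 2 + ε ^ 2))⁻¹ * ‖v‖
      = 2⁻¹ * π⁻¹ * ((‖x‖ ^ 2 + ε ^ 2)⁻¹ * ‖v‖) := by field_simp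
  have h5 : π⁻¹ ≤ 3⁻¹ := inv_anti₀ (by norm_num) hpi.le
  have h6 : 0 ≤ (‖x‖ ^ 2 + ε ^ 2)⁻¹ * ‖v‖ := by positivity
  nlinarith [mul_le_mul_of_nonneg_right h5 h6]

lemma norm_regKernel_le (hε : 0 < ε) (x : E2) :
    ‖regKernel ε x‖ ≤ √((‖x‖ ^ 2 + ε ^ 2)⁻¹) := by
  have hq : 0 < ‖x‖ ^ 2 + ε ^ 2 := by positivity
  have hpi := Real.pi_gt_three
  refine Real.le_sqrt_of_sq_le ?_
  rw [regKernel, norm_smul, Real.norm_of_nonneg (by positivity), mul_pow, inv_pow, mul_pow,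
    inv_mul_le_iff₀ (by positivity)]
  have h1 : (1 : ℝ) ≤ (2 * π) ^ 2 := by nlinarith
  have h2 : (‖x‖ ^ 2 + ε ^ 2) ^ 2 * (‖x‖ ^ 2 + ε ^ 2)⁻¹ = ‖x‖ ^ 2 + ε ^ 2 := by field_simp
  rw [mul_assoc, h2]
  nlinarith [sq_nonneg ‖x‖, sq_nonneg ε]

lemma sum_regKernelDeriv_apply (hε : 0 < ε) (x : E2) :
    ∑ i : Fin 2, (regKernelDeriv ε x (EuclideanSpace.single i 1)) i = regDelta ε x := by
  have hq : 0 < ‖x‖ ^ 2 + ε ^ 2 := by positivity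
  have h : ‖x‖ ^ 2 = x 0 ^ 2 + x 1 ^ 2 := by
    rw [EuclideanSpace.real_norm_sq_eq, Fin.sum_univ_two]
  simp [Fin.sum_univ_two, regKernelDeriv, regDelta, EuclideanSpace.inner_single_right]
  field_simp
  rw [h]
  ring

lemma integral_regDelta (hε : 0 < ε) :
    Integrable (regDelta ε) ∧ ∫ x, regDelta ε x = 1 := by
  have hq : ∀ r : ℝ, r ^ 2 + ε ^ 2 ≠ 0 := fun r => by positivity
  have hder : ∀ r : ℝ, HasDerivAt (fun r : ℝ => -(ε ^ 2 / (2 * π)) * (r ^ 2 + ε ^ 2)⁻¹)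
      (r * (ε ^ 2 / (π * (r ^ 2 + ε ^ 2) ^ 2))) r := by
    intro r
    have h1 : HasDerivAt (fun r : ℝ => r ^ 2 + ε ^ 2) (2 * r) r := by
      simpa using (hasDerivAt_pow 2 r).add_const (ε ^ 2)
    refine ((h1.inv (hq r)).const_mul (-(ε ^ 2 / (2 * π)))).congr_deriv ?_
    have := hq r
    field_simp
  have hlim : Tendsto (fun r : ℝ => -(ε ^ 2 / (2 * π)) * (r ^ 2 + ε ^ 2)⁻¹) atTop (𝓝 0) := by
    have : Tendsto (fun r : ℝ => (r ^ 2 + ε ^ 2)⁻¹) atTop (𝓝 0) :=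
      tendsto_inv_atTop_zero.comp
        (tendsto_atTop_add_const_right _ _ (tendsto_pow_atTop two_ne_zero))
    simpa using this.const_mul (-(ε ^ 2 / (2 * π)))
  have hint : IntegrableOn (fun r : ℝ => r * (ε ^ 2 / (π * (r ^ 2 + ε ^ 2) ^ 2))) (Ioi 0) :=
    integrableOn_Ioi_deriv_of_nonneg' (fun r _ => hder r)
      (fun r hr => mul_nonneg (le_of_lt hr) (by positivity)) hlim
  have hval := integral_Ioi_of_hasDerivAt_of_tendsto' (fun r _ => hder r) hint hlim
  constructor
  · have := integrable_fun_norm_addHaar (volume : Measure E2)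
      (f := fun r : ℝ => ε ^ 2 / (π * (r ^ 2 + ε ^ 2) ^ 2))
    refine this.2 ?_
    simpa using hint
  · have := integral_fun_norm_addHaar (volume : Measure E2)
      (fun r : ℝ => ε ^ 2 / (π * (r ^ 2 + ε ^ 2) ^ 2))
    unfold regDelta
    rw [this]
    simp only [finrank_euclideanSpace, Fintype.card_fin, Nat.add_one_sub_one, pow_one, smul_eq_mul]
    rw [hval, measureReal_def, EuclideanSpace.volume_ball]
    norm_num
    field_simp
    exact Real.sq_sqrt Real.pi_pos.le

end Kernels

section Dipole

variable {ε R : ℝ}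

/-- The potential created by a unit charge at `p.1` and the opposite charge at `p.2`. -/
def dipoleLog (ε : ℝ) (p : E2 × E2) (z : E2) : ℝ := regLog ε (z - p.1) - regLog ε (z - p.2)

/-- The gradient of `dipoleLog`. -/
def dipoleKernel (ε : ℝ) (p : E2 × E2) (z : E2) : E2 :=
  regKernel ε (z - p.1) - regKernel ε (z - p.2)

/-- The derivative of `dipoleKernel`. -/
def dipoleKernelDeriv (ε : ℝ) (p : E2 × E2) (z : E2) : E2 →L[ℝ] E2 :=
  regKernelDeriv ε (z - p.1) - regKernelDeriv ε (z - p.2)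

lemma hasGradientAt_dipoleLog (hε : 0 < ε) (p : E2 × E2) (z : E2) :
    HasGradientAt (dipoleLog ε p) (dipoleKernel ε p z) z := by
  have h (s : E2) : HasFDerivAt (fun z => regLog ε (z - s))
      (InnerProductSpace.toDual ℝ E2 (regKernel ε (z - s))) z :=
    (hasFDerivAt_comp_sub s).2 (hasGradientAt_iff_hasFDerivAt.1 (hasGradientAt_regLog hε (z - s)))
  rw [hasGradientAt_iff_hasFDerivAt, dipoleKernel, map_sub]
  exact (h p.1).sub (h p.2)

lemma hasFDerivAt_dipoleKernel (hε : 0 < ε) (p : E2 × E2) (z : E2) :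
    HasFDerivAt (dipoleKernel ε p) (dipoleKernelDeriv ε p z) z := by
  have h (s : E2) : HasFDerivAt (fun z => regKernel ε (z - s)) (regKernelDeriv ε (z - s)) z :=
    (hasFDerivAt_comp_sub s).2 (hasFDerivAt_regKernel hε (z - s))
  exact (h p.1).sub (h p.2)

lemma continuous_dipoleLog (hε : 0 < ε) :
    Continuous fun q : (E2 × E2) × E2 => dipoleLog ε q.1 q.2 := by
  have := continuous_regLog hε
  unfold dipoleLog
  fun_prop

lemma continuous_dipoleKernel (hε : 0 < ε) :
    Continuous fun q : (E2 × E2) × E2 => dipoleKernel ε q.1 q.2 := by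
  have := continuous_regKernel hε
  unfold dipoleKernel
  fun_prop

lemma exists_inv_norm_sub_sq_add_le (hε : 0 < ε) (hR : 0 ≤ R) :
    ∃ C : ℝ, 0 < C ∧ ∀ s ∈ Metric.closedBall (0 : E2) R, ∀ z : E2,
      (‖z - s‖ ^ 2 + ε ^ 2)⁻¹ ≤ (C * (1 + ‖z‖)⁻¹) ^ 2 := by
  refine ⟨√(2 * (1 + R) ^ 2 / ε ^ 2 + 2), by positivity, fun s hs z => ?_⟩
  have hs' : ‖s‖ ≤ R := by simpa using hs
  have h1 : ‖z‖ ≤ ‖z - s‖ + ‖s‖ := norm_le_norm_sub_add z s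
  have hz := norm_nonneg z
  have h2 : (1 + ‖z‖) ^ 2 ≤ ((1 + R) + ‖z - s‖) ^ 2 :=
    pow_le_pow_left₀ (by positivity) (by linarith) 2
  have h3 : 0 ≤ 2 * (1 + R) ^ 2 / ε ^ 2 * ‖z - s‖ ^ 2 := by positivity
  have h4 : 2 * (1 + R) ^ 2 / ε ^ 2 * ε ^ 2 = 2 * (1 + R) ^ 2 := by field_simp
  rw [mul_pow, Real.sq_sqrt (by positivity), inv_pow, ← div_eq_mul_inv,
    le_div_iff₀ (by positivity), inv_mul_le_iff₀ (by positivity)]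
  nlinarith [sq_nonneg ((1 + R) - ‖z - s‖), sq_nonneg ε]

lemma norm_sub_le_of_norm_fderiv_le {F : Type*} [NormedAddCommGroup F] [NormedSpace ℝ F]
    {h : E2 → F} {h' : E2 → E2 →L[ℝ] F} (hh : ∀ z, HasFDerivAt h (h' z) z) {B : ℝ} (hR : 0 ≤ R)
    (z : E2) (hB : ∀ s ∈ Metric.closedBall (0 : E2) R, ‖h' (z - s)‖ ≤ B)
    {s t : E2} (hs : s ∈ Metric.closedBall (0 : E2) R) (ht : t ∈ Metric.closedBall (0 : E2) R) :
    ‖h (z - s) - h (z - t)‖ ≤ 2 * R * B := by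
  have hB0 : 0 ≤ B := (norm_nonneg _).trans (hB 0 (by simpa using hR))
  have h1 := Convex.norm_image_sub_le_of_norm_hasFDerivWithin_le (𝕜 := ℝ)
    (f := fun s => h (z - s)) (f' := fun s => -(h' (z - s))) (C := B)
    (s := Metric.closedBall (0 : E2) R)
    (fun s _ => (((hh (z - s)).comp s ((hasFDerivAt_id s).const_sub z)).congr_fderiv
      (by ext v; simp)).hasFDerivWithinAt)
    (fun s hs => by simpa using hB s hs) (convex_closedBall _ _) ht hs
  have h2 : ‖s - t‖ ≤ 2 * R := by
    have h3 : ‖s‖ ≤ R := by simpa using hs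
    have h4 : ‖t‖ ≤ R := by simpa using ht
    linarith [norm_sub_le s t]
  nlinarith

lemma exists_dipole_bound (hε : 0 < ε) (hR : 0 ≤ R) :
    ∃ A : ℝ, 0 ≤ A ∧ ∀ p : E2 × E2, p.1 ∈ Metric.closedBall (0 : E2) R ∧
      p.2 ∈ Metric.closedBall (0 : E2) R → ∀ z : E2,
      ‖dipoleLog ε p z‖ ≤ A * (1 + ‖z‖)⁻¹ ∧ ‖dipoleKernel ε p z‖ ≤ A * (1 + ‖z‖)⁻¹ ^ 2 ∧
      ‖dipoleKernelDeriv ε p z‖ ≤ A * (1 + ‖z‖)⁻¹ ^ 2 := by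
  obtain ⟨C, hC, hCb⟩ := exists_inv_norm_sub_sq_add_le hε hR
  refine ⟨2 * R * C + 2 * R * C ^ 2 + 2 * C ^ 2, by positivity, fun p hp z => ?_⟩
  have hw : 0 ≤ (1 + ‖z‖)⁻¹ := by positivity
  have hw2 : 0 ≤ (1 + ‖z‖)⁻¹ ^ 2 := by positivity
  have hk (s : E2) (hs : s ∈ Metric.closedBall (0 : E2) R) :
      ‖InnerProductSpace.toDual ℝ E2 (regKernel ε (z - s))‖ ≤ C * (1 + ‖z‖)⁻¹ := by
    rw [LinearIsometryEquiv.norm_map]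
    refine (norm_regKernel_le hε _).trans ?_
    rw [← Real.sqrt_sq (show 0 ≤ C * (1 + ‖z‖)⁻¹ by positivity)]
    exact Real.sqrt_le_sqrt (hCb s hs z)
  have hd (s : E2) (hs : s ∈ Metric.closedBall (0 : E2) R) :
      ‖regKernelDeriv ε (z - s)‖ ≤ C ^ 2 * (1 + ‖z‖)⁻¹ ^ 2 := by
    rw [← mul_pow]
    exact (norm_regKernelDeriv_le hε _).trans (hCb s hs z)
  have h1 := norm_sub_le_of_norm_fderiv_le
    (fun z => hasGradientAt_iff_hasFDerivAt.1 (hasGradientAt_regLog hε z)) hR z hk hp.1 hp.2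
  have h2 := norm_sub_le_of_norm_fderiv_le (hasFDerivAt_regKernel hε) hR z hd hp.1 hp.2
  have h3 := (norm_sub_le _ _).trans (add_le_add (hd _ hp.1) (hd _ hp.2))
  have a1 : 0 ≤ 2 * R * C := by positivity
  have a2 : 0 ≤ 2 * R * C ^ 2 := by positivity
  have a3 : 0 ≤ 2 * C ^ 2 := by positivity
  refine ⟨h1.trans ?_, h2.trans ?_, h3.trans ?_⟩
  · nlinarith [mul_nonneg a2 hw, mul_nonneg a3 hw]
  · nlinarith [mul_nonneg a1 hw2, mul_nonneg a3 hw2]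
  · nlinarith [mul_nonneg a1 hw2, mul_nonneg a2 hw2]

lemma integrable_inv_one_add_norm_pow_three :
    Integrable fun z : E2 => (1 + ‖z‖)⁻¹ ^ 3 := by
  have h := integrable_one_add_norm (E := E2) (μ := volume) (r := 3) (by norm_num)
  refine h.congr (Eventually.of_forall fun z => ?_)
  have hz : 0 ≤ 1 + ‖z‖ := by positivity
  simp only
  rw [Real.rpow_neg hz, inv_pow]
  norm_cast

end Dipole

section DipoleField

variable {ε R : ℝ}

/-- The regularized potential of the difference of the marginals of `γ`. -/
def dipolePotential (ε : ℝ) (γ : Measure (E2 × E2)) (z : E2) : ℝ := ∫ p, dipoleLog ε p z ∂γ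

/-- The gradient of `dipolePotential`. -/
def dipoleField (ε : ℝ) (γ : Measure (E2 × E2)) (z : E2) : E2 := ∫ p, dipoleKernel ε p z ∂γ

lemma continuous_dipoleKernel_charge (hε : 0 < ε) (z : E2) :
    Continuous fun p : E2 × E2 => dipoleKernel ε p z := by
  have := continuous_regKernel hε
  unfold dipoleKernel
  fun_prop

lemma inv_one_add_norm_le_one (z : E2) : (1 + ‖z‖)⁻¹ ≤ 1 :=
  inv_le_one_of_one_le₀ (by linarith [norm_nonneg z])

lemma inv_one_add_norm_sq_le_one (z : E2) : (1 + ‖z‖)⁻¹ ^ 2 ≤ 1 :=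
  pow_le_one₀ (by positivity) (inv_one_add_norm_le_one z)

lemma hasGradientAt_dipolePotential {γ : Measure (E2 × E2)} [IsFiniteMeasure γ] (hε : 0 < ε)
    (hR : 0 ≤ R) (hγ : ∀ᵐ p ∂γ, p.1 ∈ Metric.closedBall (0 : E2) R ∧
      p.2 ∈ Metric.closedBall (0 : E2) R) (z : E2) :
    HasGradientAt (dipolePotential ε γ) (dipoleField ε γ z) z := by
  obtain ⟨A, hA, hAb⟩ := exists_dipole_bound hε hR
  have hk (z : E2) : AEStronglyMeasurable (fun p => dipoleKernel ε p z) γ :=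
    (continuous_dipoleKernel_charge hε z).aestronglyMeasurable
  have hl (z : E2) : AEStronglyMeasurable (fun p => dipoleLog ε p z) γ :=
    ((continuous_dipoleLog hε).comp (Continuous.prodMk_left z)).aestronglyMeasurable
  have hkint : Integrable (fun p => dipoleKernel ε p z) γ :=
    .of_bound (hk z) (A * (1 + ‖z‖)⁻¹ ^ 2) (hγ.mono fun p hp => (hAb p hp z).2.1)
  have hlint : Integrable (fun p => dipoleLog ε p z) γ :=
    .of_bound (hl z) (A * (1 + ‖z‖)⁻¹) (hγ.mono fun p hp => (hAb p hp z).1)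
  have h := hasFDerivAt_integral_of_dominated_of_fderiv_le (μ := γ) (𝕜 := ℝ) (s := univ) (x₀ := z)
    (F := fun z p => dipoleLog ε p z) (F' := fun z p => innerSL ℝ (dipoleKernel ε p z))
    (bound := fun _ => A) univ_mem (Eventually.of_forall hl) hlint
    ((innerSL ℝ).continuous.comp_aestronglyMeasurable (hk z))
    (hγ.mono fun p hp x _ => by
      rw [innerSL_apply_norm]
      exact (hAb p hp x).2.1.trans (mul_le_of_le_one_right hA (inv_one_add_norm_sq_le_one x)))
    (integrable_const A)
    (Eventually.of_forall fun p x _ => (hasGradientAt_dipoleLog hε p x))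
  rw [ContinuousLinearMap.integral_comp_comm _ hkint] at h
  exact h

lemma continuous_dipoleField {γ : Measure (E2 × E2)} [IsFiniteMeasure γ] (hε : 0 < ε)
    (hR : 0 ≤ R) (hγ : ∀ᵐ p ∂γ, p.1 ∈ Metric.closedBall (0 : E2) R ∧
      p.2 ∈ Metric.closedBall (0 : E2) R) : Continuous (dipoleField ε γ) := by
  obtain ⟨A, hA, hAb⟩ := exists_dipole_bound hε hR
  refine continuous_of_dominated (F := fun z p => dipoleKernel ε p z) (bound := fun _ => A)
    (fun z => ?_) (fun z => hγ.mono fun p hp => (hAb p hp z).2.1.trans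
      (mul_le_of_le_one_right hA (inv_one_add_norm_sq_le_one z))) (integrable_const A)
    (Eventually.of_forall fun p => ?_)
  · exact (continuous_dipoleKernel_charge hε z).aestronglyMeasurable
  · exact continuous_iff_continuousAt.2 fun z => (hasFDerivAt_dipoleKernel hε p z).continuousAt

lemma exists_dipoleField_bound {γ : Measure (E2 × E2)} [IsFiniteMeasure γ] (hε : 0 < ε)
    (hR : 0 ≤ R) (hγ : ∀ᵐ p ∂γ, p.1 ∈ Metric.closedBall (0 : E2) R ∧
      p.2 ∈ Metric.closedBall (0 : E2) R) :
    ∃ A : ℝ, 0 ≤ A ∧ ∀ z, ‖dipolePotential ε γ z‖ ≤ A * (1 + ‖z‖)⁻¹ ∧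
      ‖dipoleField ε γ z‖ ≤ A * (1 + ‖z‖)⁻¹ ^ 2 := by
  obtain ⟨A, hA, hAb⟩ := exists_dipole_bound hε hR
  refine ⟨A * γ.real univ, by positivity, fun z => ⟨?_, ?_⟩⟩
  · exact (norm_integral_le_of_norm_le_const (hγ.mono fun p hp => (hAb p hp z).1)).trans_eq
      (by ring)
  · exact (norm_integral_le_of_norm_le_const (hγ.mono fun p hp => (hAb p hp z).2.1)).trans_eq
      (by ring)

lemma integral_inner_gradient_eq {ψ : E2 → ℝ} {G k : E2 → E2} {k' : E2 → E2 →L[ℝ] E2}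
    (hψ : ∀ z, HasGradientAt ψ (G z) z) (hk : ∀ z, HasFDerivAt k (k' z) z)
    (hG : Continuous G) (hk' : Continuous k')
    (h1 : Integrable fun z => ‖G z‖ * ‖k z‖) (h2 : Integrable fun z => ‖ψ z‖ * ‖k' z‖)
    (h3 : Integrable fun z => ‖ψ z‖ * ‖k z‖) :
    ∫ z, ⟪G z, k z⟫ = -∫ z, ψ z * ∑ i : Fin 2, (k' z (EuclideanSpace.single i 1)) i := by
  have hψc : Continuous ψ := continuous_iff_continuousAt.2 fun z => (hψ z).continuousAt
  have hkc : Continuous k := continuous_iff_continuousAt.2 fun z => (hk z).continuousAt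
  have hfψ (z : E2) (i : Fin 2) : fderiv ℝ ψ z (EuclideanSpace.single i 1) = G z i := by
    rw [(hasGradientAt_iff_hasFDerivAt.1 (hψ z)).fderiv]
    simp [EuclideanSpace.inner_single_right]
  have hki (z : E2) (i : Fin 2) : HasFDerivAt (fun z => k z i)
      ((EuclideanSpace.proj i : E2 →L[ℝ] ℝ).comp (k' z)) z :=
    (EuclideanSpace.proj i : E2 →L[ℝ] ℝ).hasFDerivAt.comp z (hk z)
  have hfk (z : E2) (i : Fin 2) : fderiv ℝ (fun z => k z i) z (EuclideanSpace.single i 1)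
      = (k' z (EuclideanSpace.single i 1)) i := by
    rw [(hki z i).fderiv]
    simp
  have e1 (v : E2) (i : Fin 2) : ‖v i‖ ≤ ‖v‖ := PiLp.norm_apply_le v i
  have e2 (z : E2) (i : Fin 2) : ‖(k' z (EuclideanSpace.single i 1)) i‖ ≤ ‖k' z‖ :=
    (e1 _ i).trans (((k' z).le_opNorm _).trans_eq (by simp))
  have i1 (i : Fin 2) : Integrable fun z => G z i * k z i :=
    h1.mono' (Continuous.aestronglyMeasurable (by fun_prop)) (Eventually.of_forall fun z => by
      rw [norm_mul]
      exact mul_le_mul (e1 _ _) (e1 _ _) (norm_nonneg _) (norm_nonneg _))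
  have i2 (i : Fin 2) : Integrable fun z => ψ z * (k' z (EuclideanSpace.single i 1)) i :=
    h2.mono' (Continuous.aestronglyMeasurable (by fun_prop)) (Eventually.of_forall fun z => by
      rw [norm_mul]
      exact mul_le_mul_of_nonneg_left (e2 _ _) (norm_nonneg _))
  have i3 (i : Fin 2) : Integrable fun z => ψ z * k z i :=
    h3.mono' (Continuous.aestronglyMeasurable (by fun_prop)) (Eventually.of_forall fun z => by
      rw [norm_mul]
      exact mul_le_mul_of_nonneg_left (e1 _ _) (norm_nonneg _))
  have key (i : Fin 2) : ∫ z, ψ z * (k' z (EuclideanSpace.single i 1)) i = -∫ z, G z i * k z i := by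
    have := integral_mul_fderiv_eq_neg_fderiv_mul_of_integrable (𝕜 := ℝ) (μ := volume) (f := ψ)
      (g := fun z => k z i) (v := EuclideanSpace.single i 1)
      ((i1 i).congr (Eventually.of_forall fun z => by simp only [hfψ]))
      ((i2 i).congr (Eventually.of_forall fun z => by simp only [hfk])) (i3 i)
      (fun z _ => (hasGradientAt_iff_hasFDerivAt.1 (hψ z)).differentiableAt)
      (fun z _ => (hki z i).differentiableAt)
    simpa only [hfψ, hfk] using this
  have l : ∀ z, ⟪G z, k z⟫ = ∑ i : Fin 2, G z i * k z i := fun z => by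
    rw [PiLp.inner_apply]
    exact Finset.sum_congr rfl fun i _ => by simp [mul_comm]
  simp_rw [l, Finset.mul_sum]
  rw [integral_finsetSum _ fun i _ => i1 i, integral_finsetSum _ fun i _ => i2 i,
    ← Finset.sum_neg_distrib]
  exact Finset.sum_congr rfl fun i _ => by rw [key, neg_neg]

lemma integral_mul_regDelta_sub (hε : 0 < ε) {ψ : E2 → ℝ} (hψ : Continuous ψ) {B : ℝ}
    (hB : ∀ z, ‖ψ z‖ ≤ B) (p : E2 × E2) :
    -∫ z, ψ z * (regDelta ε (z - p.1) - regDelta ε (z - p.2))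
      = ∫ z, regDelta ε z * (ψ (z + p.2) - ψ (z + p.1)) := by
  have hi (s : E2) : Integrable fun z => ψ (z + s) * regDelta ε z :=
    (integral_regDelta hε).1.bdd_mul (c := B) (hψ.comp (continuous_add_const s)).aestronglyMeasurable
      (Eventually.of_forall fun z => hB _)
  have hi' (s : E2) : Integrable fun z => ψ z * regDelta ε (z - s) := by
    have := (hi s).comp_sub_right s
    simpa using this
  have he (s : E2) : ∫ z, ψ z * regDelta ε (z - s) = ∫ z, ψ (z + s) * regDelta ε z := by
    have := integral_add_right_eq_self (μ := volume) (fun z => ψ z * regDelta ε (z - s)) s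
    simpa using this.symm
  simp_rw [mul_sub, mul_comm (regDelta ε _)]
  rw [integral_sub (hi' _) (hi' _), integral_sub (hi _) (hi _), he, he]
  ring

end DipoleField

section DipoleEnergy

variable {ε R : ℝ} {γ : Measure (E2 × E2)} [IsFiniteMeasure γ]

lemma integrable_norm_dipoleField_sq (hε : 0 < ε) (hR : 0 ≤ R)
    (hγ : ∀ᵐ p ∂γ, p.1 ∈ Metric.closedBall (0 : E2) R ∧ p.2 ∈ Metric.closedBall (0 : E2) R) :
    Integrable fun z => ‖dipoleField ε γ z‖ ^ 2 := by
  obtain ⟨A, hA, hAb⟩ := exists_dipoleField_bound hε hR hγ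
  refine (integrable_inv_one_add_norm_pow_three.const_mul (A ^ 2)).mono'
    (((continuous_dipoleField hε hR hγ).norm.pow 2).aestronglyMeasurable)
    (Eventually.of_forall fun z => ?_)
  have hw : 0 ≤ (1 + ‖z‖)⁻¹ := by positivity
  rw [norm_pow, norm_norm]
  calc ‖dipoleField ε γ z‖ ^ 2 ≤ (A * (1 + ‖z‖)⁻¹ ^ 2) ^ 2 :=
        pow_le_pow_left₀ (norm_nonneg _) (hAb z).2 2
    _ = A ^ 2 * (1 + ‖z‖)⁻¹ ^ 3 * (1 + ‖z‖)⁻¹ := by ring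
    _ ≤ A ^ 2 * (1 + ‖z‖)⁻¹ ^ 3 :=
        mul_le_of_le_one_right (by positivity) (inv_one_add_norm_le_one z)

lemma integral_inner_dipoleField (hε : 0 < ε) (hR : 0 ≤ R)
    (hγ : ∀ᵐ p ∂γ, p.1 ∈ Metric.closedBall (0 : E2) R ∧ p.2 ∈ Metric.closedBall (0 : E2) R)
    {p : E2 × E2}
    (hp : p.1 ∈ Metric.closedBall (0 : E2) R ∧ p.2 ∈ Metric.closedBall (0 : E2) R) :
    ∫ z, ⟪dipoleField ε γ z, dipoleKernel ε p z⟫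
      = ∫ z, regDelta ε z * (dipolePotential ε γ (z + p.2) - dipolePotential ε γ (z + p.1)) := by
  obtain ⟨A, hA, hAb⟩ := exists_dipoleField_bound hε hR hγ
  obtain ⟨B, hB, hBb⟩ := exists_dipole_bound hε hR
  have hψ := hasGradientAt_dipolePotential hε hR hγ
  have hG := continuous_dipoleField hε hR hγ
  have hk := hasFDerivAt_dipoleKernel hε p
  have hψc : Continuous (dipolePotential ε γ) :=
    continuous_iff_continuousAt.2 fun z => (hψ z).continuousAt
  have hkc : Continuous (dipoleKernel ε p) :=
    continuous_iff_continuousAt.2 fun z => (hk z).continuousAt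
  have hk'c : Continuous (dipoleKernelDeriv ε p) := by
    have := continuous_regKernelDeriv hε
    unfold dipoleKernelDeriv
    fun_prop
  have hint {a b : E2 → ℝ} (ha : Continuous a) (hb : Continuous b)
      (ha0 : ∀ z, 0 ≤ a z) (hb0 : ∀ z, 0 ≤ b z) (ha1 : ∀ z, a z ≤ A * (1 + ‖z‖)⁻¹)
      (hb1 : ∀ z, b z ≤ B * (1 + ‖z‖)⁻¹ ^ 2) : Integrable fun z => a z * b z := by
    refine (integrable_inv_one_add_norm_pow_three.const_mul (A * B)).mono'
      (ha.mul hb).aestronglyMeasurable (Eventually.of_forall fun z => ?_)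
    rw [Real.norm_of_nonneg (mul_nonneg (ha0 z) (hb0 z))]
    calc a z * b z ≤ (A * (1 + ‖z‖)⁻¹) * (B * (1 + ‖z‖)⁻¹ ^ 2) :=
          mul_le_mul (ha1 z) (hb1 z) (hb0 z) (by positivity)
      _ = A * B * (1 + ‖z‖)⁻¹ ^ 3 := by ring
  have h := integral_inner_gradient_eq hψ hk hG hk'c
    (hint hG.norm hkc.norm (fun _ => norm_nonneg _) (fun _ => norm_nonneg _)
      (fun z => (hAb z).2.trans (mul_le_mul_of_nonneg_left
        (pow_le_of_le_one (by positivity) (inv_one_add_norm_le_one z) two_ne_zero) hA))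
      (fun z => (hBb p hp z).2.1))
    (hint hψc.norm hk'c.norm (fun _ => norm_nonneg _) (fun _ => norm_nonneg _)
      (fun z => (hAb z).1) (fun z => (hBb p hp z).2.2))
    (hint hψc.norm hkc.norm (fun _ => norm_nonneg _) (fun _ => norm_nonneg _)
      (fun z => (hAb z).1) (fun z => (hBb p hp z).2.1))
  rw [h, ← integral_mul_regDelta_sub hε hψc (B := A)
    (fun z => (hAb z).1.trans (mul_le_of_le_one_right hA (inv_one_add_norm_le_one z))) p]
  congr 2
  ext z
  rw [← sum_regKernelDeriv_apply hε, ← sum_regKernelDeriv_apply hε, ← Finset.sum_sub_distrib]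
  simp [dipoleKernelDeriv]

lemma integral_norm_dipoleField_sq_eq (hε : 0 < ε) (hR : 0 ≤ R)
    (hγ : ∀ᵐ p ∂γ, p.1 ∈ Metric.closedBall (0 : E2) R ∧ p.2 ∈ Metric.closedBall (0 : E2) R) :
    ∫ z, ‖dipoleField ε γ z‖ ^ 2 = ∫ z, regDelta ε z *
      ∫ p, (dipolePotential ε γ (z + p.2) - dipolePotential ε γ (z + p.1)) ∂γ := by
  obtain ⟨A, hA, hAb⟩ := exists_dipoleField_bound hε hR hγ
  obtain ⟨B, hB, hBb⟩ := exists_dipole_bound hε hR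
  have hG := continuous_dipoleField hε hR hγ
  have hψc : Continuous (dipolePotential ε γ) :=
    continuous_iff_continuousAt.2 fun z => (hasGradientAt_dipolePotential hε hR hγ z).continuousAt
  have hk := continuous_dipoleKernel hε
  have hδ := continuous_regDelta hε
  have i1 : Integrable (fun q : E2 × (E2 × E2) =>
      ⟪dipoleField ε γ q.1, dipoleKernel ε q.2 q.1⟫) (volume.prod γ) := by
    refine ((integrable_inv_one_add_norm_pow_three.const_mul (A * B)).comp_fst γ).mono'
      (Continuous.inner (hG.comp continuous_fst)
        (hk.comp continuous_swap)).aestronglyMeasurable ?_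
    filter_upwards [Measure.quasiMeasurePreserving_snd.ae hγ] with q hq
    have hw : 0 ≤ (1 + ‖q.1‖)⁻¹ := by positivity
    calc ‖⟪dipoleField ε γ q.1, dipoleKernel ε q.2 q.1⟫‖
        ≤ ‖dipoleField ε γ q.1‖ * ‖dipoleKernel ε q.2 q.1‖ := norm_inner_le_norm _ _
      _ ≤ (A * (1 + ‖q.1‖)⁻¹ ^ 2) * (B * (1 + ‖q.1‖)⁻¹ ^ 2) :=
          mul_le_mul (hAb _).2 (hBb _ hq _).2.1 (norm_nonneg _) (by positivity)
      _ = A * B * (1 + ‖q.1‖)⁻¹ ^ 3 * (1 + ‖q.1‖)⁻¹ := by ring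
      _ ≤ A * B * (1 + ‖q.1‖)⁻¹ ^ 3 :=
          mul_le_of_le_one_right (by positivity) (inv_one_add_norm_le_one _)
  have i2 : Integrable (fun q : (E2 × E2) × E2 => regDelta ε q.2 *
      (dipolePotential ε γ (q.2 + q.1.2) - dipolePotential ε γ (q.2 + q.1.1)))
      (γ.prod volume) := by
    refine (((integral_regDelta hε).1.mul_const (2 * A)).comp_snd γ).mono'
      (Continuous.aestronglyMeasurable (by fun_prop)) (Eventually.of_forall fun q => ?_)
    rw [norm_mul, Real.norm_of_nonneg (regDelta_nonneg _)]
    have hb (z : E2) : ‖dipolePotential ε γ z‖ ≤ A :=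
      (hAb z).1.trans (mul_le_of_le_one_right hA (inv_one_add_norm_le_one z))
    exact mul_le_mul_of_nonneg_left
      ((norm_sub_le _ _).trans ((add_le_add (hb _) (hb _)).trans_eq (two_mul A).symm))
      (regDelta_nonneg _)
  calc ∫ z, ‖dipoleField ε γ z‖ ^ 2
      = ∫ z, ∫ p, ⟪dipoleField ε γ z, dipoleKernel ε p z⟫ ∂γ := by
        congr 1
        ext z
        have hki : Integrable (fun p => dipoleKernel ε p z) γ :=
          .of_bound (continuous_dipoleKernel_charge hε z).aestronglyMeasurable
            (B * (1 + ‖z‖)⁻¹ ^ 2) (hγ.mono fun p hp => (hBb p hp z).2.1)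
        rw [integral_inner hki, ← real_inner_self_eq_norm_sq]
        rfl
    _ = ∫ p, (∫ z, ⟪dipoleField ε γ z, dipoleKernel ε p z⟫) ∂γ := integral_integral_swap i1
    _ = ∫ p, (∫ z, regDelta ε z *
          (dipolePotential ε γ (z + p.2) - dipolePotential ε γ (z + p.1))) ∂γ :=
        integral_congr_ae (hγ.mono fun p hp => integral_inner_dipoleField hε hR hγ hp)
    _ = ∫ z, ∫ p, regDelta ε z *
          (dipolePotential ε γ (z + p.2) - dipolePotential ε γ (z + p.1)) ∂γ :=
        integral_integral_swap i2
    _ = _ := by simp_rw [integral_const_mul]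

theorem integral_norm_dipoleField_sq_le {M : ℝ≥0} (hε : 0 < ε) (hR : 0 ≤ R)
    (hγ : ∀ᵐ p ∂γ, p.1 ∈ Metric.closedBall (0 : E2) R ∧ p.2 ∈ Metric.closedBall (0 : E2) R)
    (h1 : γ.map Prod.fst ≤ (M : ℝ≥0∞) • volume) (h2 : γ.map Prod.snd ≤ (M : ℝ≥0∞) • volume) :
    ∫ z, ‖dipoleField ε γ z‖ ^ 2 ≤ M * ∫ p, ‖p.1 - p.2‖ ^ 2 ∂γ := by
  set D := ∫ z, ‖dipoleField ε γ z‖ ^ 2 with hD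
  set c := ∫ p, ‖p.1 - p.2‖ ^ 2 ∂γ with hc
  have hD0 : 0 ≤ D := integral_nonneg fun z => sq_nonneg _
  have hc0 : 0 ≤ c := integral_nonneg fun z => sq_nonneg _
  have hsq := integrable_norm_dipoleField_sq hε hR hγ
  have key (z : E2) : ∫ p, (dipolePotential ε γ (z + p.2) - dipolePotential ε γ (z + p.1)) ∂γ
      ≤ √(M * D) * √c := by
    have hg (y : E2) : HasGradientAt (fun y => -dipolePotential ε γ (z + y))
        (-dipoleField ε γ (z + y)) y := by
      rw [hasGradientAt_iff_hasFDerivAt, map_neg]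
      exact ((hasFDerivAt_comp_add_left z).2
        (hasGradientAt_iff_hasFDerivAt.1 (hasGradientAt_dipolePotential hε hR hγ (z + y)))).neg
    have := integral_sub_le_of_coupling hR hγ h1 h2 hg
      ((continuous_dipoleField hε hR hγ).comp (continuous_const_add z)).neg
      (by simpa using hsq.comp_add_left z)
    simp only [norm_neg, neg_sub_neg] at this
    rwa [integral_add_left_eq_self (fun y => ‖dipoleField ε γ y‖ ^ 2) z] at this
  have hδ := integral_regDelta hε
  have hle : D ≤ √(M * D) * √c := by
    by_cases hi : Integrable fun z => regDelta ε z *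
      ∫ p, (dipolePotential ε γ (z + p.2) - dipolePotential ε γ (z + p.1)) ∂γ
    · calc D = _ := integral_norm_dipoleField_sq_eq hε hR hγ
        _ ≤ ∫ z, regDelta ε z * (√(M * D) * √c) :=
          integral_mono hi (hδ.1.mul_const _) fun z =>
            mul_le_mul_of_nonneg_left (key z) (regDelta_nonneg z)
        _ = √(M * D) * √c := by rw [integral_mul_const, hδ.2, one_mul]
    · rw [hD, integral_norm_dipoleField_sq_eq hε hR hγ, integral_undef hi]
      positivity
  rcases hD0.eq_or_lt with h0 | h0
  · rw [← h0]
    positivity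
  · have h3 : D * D ≤ D * (M * c) := by
      calc D * D ≤ (√(M * D) * √c) * (√(M * D) * √c) := mul_self_le_mul_self hD0 hle
        _ = (√(M * D) * √(M * D)) * (√c * √c) := by ring
        _ = D * (M * c) := by
          rw [Real.mul_self_sqrt (by positivity), Real.mul_self_sqrt hc0]
          ring
    exact le_of_mul_le_mul_left h3 h0

end DipoleEnergy

section Limit

/-- The rotation `perp` as a linear isometry. -/
def perpIsometry : E2 →ₗᵢ[ℝ] E2 where
  toFun := perp
  map_add' x y := by
    ext i
    fin_cases i <;> simp [perp, add_comm]
  map_smul' c x := by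
    ext i
    fin_cases i <;> simp [perp]
  norm_map' x := by
    simp [perp, EuclideanSpace.norm_eq, Fin.sum_univ_two, add_comm]

lemma perpIsometry_apply (x : E2) : perpIsometry x = perp x := rfl

lemma biotSavartKernel_eq (x : E2) :
    biotSavartKernel x = (2 * π * ‖x‖ ^ 2)⁻¹ • perpIsometry x := by
  rw [perpIsometry_apply, biotSavartKernel, one_div]

lemma norm_biotSavartKernel (x : E2) : ‖biotSavartKernel x‖ = (2 * π)⁻¹ * ‖x‖⁻¹ := by
  rw [biotSavartKernel_eq, norm_smul, LinearIsometry.norm_map,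
    Real.norm_of_nonneg (by positivity)]
  rcases eq_or_ne ‖x‖ 0 with h | h
  · simp [h]
  · field_simp

lemma norm_perp_regKernel_le (ε : ℝ) (x : E2) :
    ‖perpIsometry (regKernel ε x)‖ ≤ ‖biotSavartKernel x‖ := by
  rcases eq_or_ne x 0 with rfl | h
  · simp [regKernel]
  · rw [LinearIsometry.norm_map, biotSavartKernel_eq, regKernel, norm_smul, norm_smul,
      LinearIsometry.norm_map, Real.norm_of_nonneg (by positivity),
      Real.norm_of_nonneg (by positivity)]
    gcongr
    linarith [sq_nonneg ε]

lemma tendsto_perp_regKernel {ε : ℕ → ℝ} (hε : Tendsto ε atTop (𝓝 0)) (x : E2) :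
    Tendsto (fun n => perpIsometry (regKernel (ε n) x)) atTop (𝓝 (biotSavartKernel x)) := by
  simp_rw [regKernel, map_smul, biotSavartKernel_eq]
  rcases eq_or_ne x 0 with rfl | h
  · simp
  · refine Tendsto.smul_const (Tendsto.inv₀ ?_ (by positivity)) _
    simpa using ((hε.pow 2).const_add (‖x‖ ^ 2)).const_mul (2 * π)

lemma measurable_biotSavartKernel : Measurable biotSavartKernel := by
  rw [funext biotSavartKernel_eq]
  have : Measurable perpIsometry := perpIsometry.continuous.measurable
  fun_prop

lemma integrable_indicator_ball_inv_norm :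
    Integrable fun x : E2 => indicator (Ioo (0 : ℝ) 1) (fun r => r⁻¹) ‖x‖ := by
  refine (integrable_fun_norm_addHaar (volume : Measure E2)
    (f := indicator (Ioo (0 : ℝ) 1) fun r => r⁻¹)).2 ?_
  have h : IntegrableOn (indicator (Ioo (0 : ℝ) 1) fun _ => (1 : ℝ)) (Ioi 0) :=
    ((integrable_indicator_iff measurableSet_Ioo).2 (integrableOn_const (by simp))).integrableOn
  refine h.congr_fun (fun r hr => ?_) measurableSet_Ioi
  have hr' : r ≠ 0 := ne_of_gt hr
  by_cases hm : r ∈ Ioo (0 : ℝ) 1 <;> simp [hm, hr']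

lemma integrable_biotSavartKernel_sub {M : ℝ≥0} {μ : Measure E2} [IsFiniteMeasure μ]
    (hμ : μ ≤ (M : ℝ≥0∞) • volume) (x : E2) :
    Integrable (fun y => biotSavartKernel (x - y)) μ := by
  have h1 := integrable_indicator_ball_inv_norm.comp_sub_left x
  have h2 : Integrable (fun y : E2 => indicator (Ioo (0 : ℝ) 1) (fun r => r⁻¹) ‖x - y‖) μ :=
    (h1.smul_measure (c := (M : ℝ≥0∞)) (by simp)).mono_measure hμ
  refine (h2.add (integrable_const (1 : ℝ))).mono'
    (measurable_biotSavartKernel.comp (measurable_const.sub measurable_id)).aestronglyMeasurable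
    (Eventually.of_forall fun y => ?_)
  have hpi : (2 * π)⁻¹ ≤ 1 := inv_le_one_of_one_le₀ (by linarith [Real.pi_gt_three])
  rw [norm_biotSavartKernel]
  refine (mul_le_of_le_one_left (by positivity) hpi).trans ?_
  simp only [Pi.add_apply]
  by_cases hm : ‖x - y‖ ∈ Ioo (0 : ℝ) 1
  · rw [indicator_of_mem hm]
    linarith
  · rw [indicator_of_notMem hm, zero_add]
    rcases (norm_nonneg (x - y)).eq_or_lt with h | h
    · simp [← h]
    · exact inv_le_one_of_one_le₀ (not_lt.1 fun h' => hm ⟨h, h'⟩)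

lemma withDensity_ofReal_le {f : E2 → ℝ} {M : ℝ≥0} (hM : eLpNorm f ⊤ volume ≤ M) :
    volume.withDensity (fun x => ENNReal.ofReal (f x)) ≤ (M : ℝ≥0∞) • volume := by
  rw [← withDensity_const]
  refine withDensity_mono ?_
  filter_upwards [enorm_ae_le_eLpNormEssSup f volume] with x hx
  rw [← eLpNorm_exponent_top] at hx
  exact (Real.ofReal_le_enorm _).trans (hx.trans hM)

lemma biotSavart_eq_integral {f : E2 → ℝ} (hf : AEStronglyMeasurable f volume)
    (hfpos : ∀ x, 0 ≤ f x) (x : E2) :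
    biotSavart f x = ∫ y, biotSavartKernel (x - y)
      ∂volume.withDensity (fun y => ENNReal.ofReal (f y)) := by
  rw [integral_withDensity_eq_integral_toReal_smul₀ hf.aemeasurable.ennreal_ofReal (by simp)]
  simp [biotSavart, hfpos]

lemma isFiniteMeasure_withDensity_ofReal_of_memLp {f : E2 → ℝ} (hf : MemLp f 1 volume) :
    IsFiniteMeasure (volume.withDensity fun x => ENNReal.ofReal (f x)) :=
  isFiniteMeasure_withDensity_ofReal (memLp_one_iff_integrable.1 hf).2

lemma tendsto_perp_dipoleField {γ : Measure (E2 × E2)}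
    {ε : ℕ → ℝ} (hε0 : ∀ n, 0 < ε n) (hε : Tendsto ε atTop (𝓝 0)) (x : E2)
    (h1 : Integrable (fun p => biotSavartKernel (x - p.1)) γ)
    (h2 : Integrable (fun p => biotSavartKernel (x - p.2)) γ) :
    Tendsto (fun n : ℕ => perpIsometry (dipoleField (ε n)
      (γ.restrict (Metric.closedBall 0 n ×ˢ Metric.closedBall 0 n)) x)) atTop
      (𝓝 (∫ p, (biotSavartKernel (x - p.1) - biotSavartKernel (x - p.2)) ∂γ)) := by
  have hmeas (n : ℕ) : MeasurableSet
      (Metric.closedBall (0 : E2) n ×ˢ Metric.closedBall (0 : E2) n) :=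
    Metric.isClosed_closedBall.measurableSet.prod Metric.isClosed_closedBall.measurableSet
  simp_rw [dipoleField, ← perpIsometry.integral_comp_comm, ← integral_indicator (hmeas _)]
  refine tendsto_integral_of_dominated_convergence
    (fun p => ‖biotSavartKernel (x - p.1)‖ + ‖biotSavartKernel (x - p.2)‖)
    (fun n => ?_) (h1.norm.add h2.norm) (fun n => ?_) ?_
  · exact ((perpIsometry.continuous.comp
      (continuous_dipoleKernel_charge (hε0 n) x)).aestronglyMeasurable).indicator (hmeas n)
  · refine Eventually.of_forall fun p => (norm_indicator_le_norm_self _ _).trans ?_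
    rw [dipoleKernel, map_sub]
    exact (norm_sub_le _ _).trans
      (add_le_add (norm_perp_regKernel_le _ _) (norm_perp_regKernel_le _ _))
  · refine Eventually.of_forall fun p => ?_
    have h3 : Tendsto (fun n => perpIsometry (dipoleKernel (ε n) p x)) atTop
        (𝓝 (biotSavartKernel (x - p.1) - biotSavartKernel (x - p.2))) := by
      simp_rw [dipoleKernel, map_sub]
      exact (tendsto_perp_regKernel hε _).sub (tendsto_perp_regKernel hε _)
    refine h3.congr' ?_
    obtain ⟨N, hN⟩ := exists_nat_ge (max ‖p.1‖ ‖p.2‖)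
    filter_upwards [eventually_ge_atTop N] with n hn
    have hn' : max ‖p.1‖ ‖p.2‖ ≤ n := hN.trans (by exact_mod_cast hn)
    rw [indicator_of_mem]
    simpa using max_le_iff.1 hn'

lemma ae_restrict_closedBall_prod (γ : Measure (E2 × E2)) (R : ℝ) :
    ∀ᵐ p ∂γ.restrict (Metric.closedBall 0 R ×ˢ Metric.closedBall 0 R),
      p.1 ∈ Metric.closedBall (0 : E2) R ∧ p.2 ∈ Metric.closedBall (0 : E2) R :=
  ae_restrict_mem
    (Metric.isClosed_closedBall.measurableSet.prod Metric.isClosed_closedBall.measurableSet)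

lemma eLpNorm_dipoleField_le {M : ℝ≥0} {γ : Measure (E2 × E2)} [IsFiniteMeasure γ]
    (h1 : γ.map Prod.fst ≤ (M : ℝ≥0∞) • volume) (h2 : γ.map Prod.snd ≤ (M : ℝ≥0∞) • volume)
    {ε : ℝ} (hε : 0 < ε) {R : ℝ} (hR : 0 ≤ R) :
    eLpNorm (dipoleField ε (γ.restrict (Metric.closedBall 0 R ×ˢ Metric.closedBall 0 R))) 2 volume
      ≤ (M : ℝ≥0∞) ^ (1 / 2 : ℝ)
        * (∫⁻ p, ENNReal.ofReal (‖p.1 - p.2‖ ^ 2) ∂γ) ^ (1 / 2 : ℝ) := by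
  set γ' := γ.restrict (Metric.closedBall 0 R ×ˢ Metric.closedBall 0 R)
  have hγ' : ∀ᵐ p ∂γ', p.1 ∈ Metric.closedBall (0 : E2) R ∧ p.2 ∈ Metric.closedBall (0 : E2) R :=
    ae_restrict_closedBall_prod γ R
  have h1' := (Measure.map_mono (Measure.restrict_le_self : γ' ≤ γ) measurable_fst).trans h1
  have h2' := (Measure.map_mono (Measure.restrict_le_self : γ' ≤ γ) measurable_snd).trans h2
  have hcost : ENNReal.ofReal (∫ p, ‖p.1 - p.2‖ ^ 2 ∂γ')
      ≤ ∫⁻ p, ENNReal.ofReal (‖p.1 - p.2‖ ^ 2) ∂γ := by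
    rw [integral_eq_lintegral_of_nonneg_ae (Eventually.of_forall fun p => sq_nonneg _)
      (Continuous.aestronglyMeasurable (by fun_prop))]
    exact ENNReal.ofReal_toReal_le.trans (lintegral_mono' Measure.restrict_le_self le_rfl)
  have hle := integral_norm_dipoleField_sq_le hε hR hγ' h1' h2'
  have hint := integrable_norm_dipoleField_sq hε hR hγ'
  rw [eLpNorm_eq_lintegral_rpow_enorm_toReal two_ne_zero ENNReal.ofNat_ne_top,
    ← ENNReal.mul_rpow_of_nonneg _ _ (by norm_num)]
  simp only [ENNReal.toReal_ofNat]
  refine ENNReal.rpow_le_rpow ?_ (by norm_num)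
  calc ∫⁻ z, ‖dipoleField ε γ' z‖ₑ ^ (2 : ℝ)
      = ∫⁻ z, ENNReal.ofReal (‖dipoleField ε γ' z‖ ^ 2) := by
        congr 1
        ext z
        rw [ENNReal.ofReal_pow (norm_nonneg _), ofReal_norm, ← ENNReal.rpow_natCast]
        norm_num
    _ = ENNReal.ofReal (∫ z, ‖dipoleField ε γ' z‖ ^ 2) :=
        (ofReal_integral_eq_lintegral_ofReal hint
          (Eventually.of_forall fun z => sq_nonneg _)).symm
    _ ≤ ENNReal.ofReal (M * ∫ p, ‖p.1 - p.2‖ ^ 2 ∂γ') := ENNReal.ofReal_le_ofReal hle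
    _ = M * ENNReal.ofReal (∫ p, ‖p.1 - p.2‖ ^ 2 ∂γ') := by
        rw [ENNReal.ofReal_mul M.coe_nonneg, ENNReal.ofReal_coe_nnreal]
    _ ≤ _ := mul_le_mul_right hcost _

end Limit

end Auxiliary

/-- **Loeper's estimate**: the `L²` distance of the Biot–Savart velocities (i.e. the `Ḣ^{-1}`
distance of the vorticities) is dominated by `max(‖f‖_∞, ‖g‖_∞)^{1/2}` times the square root
of the quadratic cost of any coupling of `f` and `g`; in particular
`‖f − g‖_{Ḣ^{−1}} ≤ max(‖f‖_{L^∞}, ‖g‖_{L^∞})^{1/2} W₂(f,g)`. -/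
theorem velocity_L2_le_W2 (f g : E2 → ℝ)
    (hf1 : MemLp f 1 volume) (hfinf : MemLp f ⊤ volume)
    (hg1 : MemLp g 1 volume) (hginf : MemLp g ⊤ volume)
    (hfpos : ∀ x, 0 ≤ f x) (hgpos : ∀ x, 0 ≤ g x)
    (hmass : ∫ x : E2, f x = ∫ x : E2, g x)
    (γ : Measure (E2 × E2)) (hγ : IsCoupling f g γ) :
    eLpNorm (fun x => biotSavart f x - biotSavart g x) 2 volume
      ≤ max (eLpNorm f ⊤ volume) (eLpNorm g ⊤ volume) ^ (1 / 2 : ℝ)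
        * (∫⁻ p : E2 × E2, ENNReal.ofReal (‖p.1 - p.2‖ ^ 2) ∂γ) ^ (1 / 2 : ℝ) := by
  obtain ⟨M, hM⟩ : ∃ M : NNReal, (M : ℝ≥0∞) = max (eLpNorm f ⊤ volume) (eLpNorm g ⊤ volume) :=
    ⟨_, ENNReal.coe_toNNReal (max_lt hfinf.2 hginf.2).ne⟩
  have hMf := withDensity_ofReal_le ((le_max_left _ _).trans_eq hM.symm)
  have hMg := withDensity_ofReal_le ((le_max_right _ _).trans_eq hM.symm)
  have hfin := isFiniteMeasure_withDensity_ofReal_of_memLp hf1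
  have hgin := isFiniteMeasure_withDensity_ofReal_of_memLp hg1
  obtain ⟨hγ1, hγ2⟩ := hγ
  have : IsFiniteMeasure γ := by
    rw [← hγ1] at hfin
    exact Measure.isFiniteMeasure_of_map measurable_fst.aemeasurable
  have hK1 (x : E2) : Integrable (fun p : E2 × E2 => biotSavartKernel (x - p.1)) γ := by
    have h := integrable_biotSavartKernel_sub hMf x
    rw [← hγ1] at h
    exact h.comp_measurable measurable_fst
  have hK2 (x : E2) : Integrable (fun p : E2 × E2 => biotSavartKernel (x - p.2)) γ := by
    have h := integrable_biotSavartKernel_sub hMg x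
    rw [← hγ2] at h
    exact h.comp_measurable measurable_snd
  have hv (x : E2) : biotSavart f x - biotSavart g x
      = ∫ p, (biotSavartKernel (x - p.1) - biotSavartKernel (x - p.2)) ∂γ := by
    have hm : Measurable fun y => biotSavartKernel (x - y) :=
      measurable_biotSavartKernel.comp (measurable_const.sub measurable_id)
    rw [integral_sub (hK1 x) (hK2 x), biotSavart_eq_integral hf1.1 hfpos,
      biotSavart_eq_integral hg1.1 hgpos, ← hγ1, ← hγ2,
      integral_map measurable_fst.aemeasurable hm.aestronglyMeasurable,
      integral_map measurable_snd.aemeasurable hm.aestronglyMeasurable]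
  have hpos (n : ℕ) : (0 : ℝ) < 1 / ((n : ℝ) + 1) := by positivity
  have hR (n : ℕ) : (0 : ℝ) ≤ n := n.cast_nonneg
  have hlim (x : E2) := tendsto_perp_dipoleField hpos tendsto_one_div_add_atTop_nhds_zero_nat x
    (hK1 x) (hK2 x)
  simp_rw [← hv] at hlim
  rw [← hM]
  rw [← hγ1] at hMf
  rw [← hγ2] at hMg
  refine (Lp.eLpNorm_lim_le_liminf_eLpNorm (fun n => ?_) _
    (Filter.Eventually.of_forall hlim)).trans
    (Filter.liminf_le_of_frequently_le' (Filter.Frequently.of_forall fun n => ?_))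
  · exact (perpIsometry.continuous.comp (continuous_dipoleField (hpos n) (hR n)
      (ae_restrict_closedBall_prod γ n))).aestronglyMeasurable
  · refine (eLpNorm_congr_norm_ae (Filter.Eventually.of_forall fun x =>
      perpIsometry.norm_map _)).trans_le (eLpNorm_dipoleField_le hMf hMg (hpos n) (hR n))
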